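/- arXiv:1601.07410 — 15 statements merged into one kernel-verified Lean document; each statement's English description precedes it below -/
import Mathlib

section
/- Let φ > 0, λ > 0, α > 0 and let f be the density of the generalized weighted Lindley distribution with these parameters. Then f is a genuine probability density on the positive half-line: ∫₀^∞ f(t) dt = 1. -/
open MeasureTheory Real

/-- The probability density function of the generalized weighted Lindley (GWL)
distribution with parameters `φ`, `lam`, `α`. -/
noncomputable def gwlPdf (φ lam α t : ℝ) : ℝ :=
  α * lam ^ (α * φ) * t ^ (α * φ - 1) * (lam + (lam * t) ^ α) *
    Real.exp (-(lam * t) ^ α) / ((lam + φ) * Real.Gamma φ)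

theorem gwl_pdf_integrates_to_one (φ lam α : ℝ) (hφ : 0 < φ) (hlam : 0 < lam)
    (hα : 0 < α) :
    ∫ t in Set.Ioi (0 : ℝ), gwlPdf φ lam α t = 1 := by
  have hb : 0 < lam ^ α := rpow_pos_of_pos hlam α
  have hG : 0 < Real.Gamma φ := Real.Gamma_pos_of_pos hφ
  have hαφ : 0 < α * φ := mul_pos hα hφ
  have h1 : -1 < α * φ - 1 := by linarith
  have h2 : -1 < α * φ - 1 + α := by linarith
  have hpow : lam ^ (α * φ) = (lam ^ α) ^ φ := rpow_mul hlam.le α φ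
  have i1 := integrableOn_rpow_mul_exp_neg_mul_rpow h1 hα hb
  have i2 := integrableOn_rpow_mul_exp_neg_mul_rpow h2 hα hb
  have e1 := integral_rpow_mul_exp_neg_mul_rpow hα h1 hb
  have e2 := integral_rpow_mul_exp_neg_mul_rpow hα h2 hb
  rw [show -(α * φ - 1 + 1) / α = -φ by field_simp; ring,
    show (α * φ - 1 + 1) / α = φ by field_simp; ring] at e1
  rw [show -(α * φ - 1 + α + 1) / α = -φ + -1 by field_simp; ring,
    show (α * φ - 1 + α + 1) / α = φ + 1 by field_simp; ring,
    Real.Gamma_add_one hφ.ne', rpow_add hb, rpow_neg_one] at e2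
  rw [rpow_neg hb.le] at e1 e2
  have key : ∀ t ∈ Set.Ioi (0 : ℝ), gwlPdf φ lam α t =
      α * lam ^ (α * φ) / ((lam + φ) * Real.Gamma φ) *
        (lam * (t ^ (α * φ - 1) * Real.exp (-lam ^ α * t ^ α)) +
          lam ^ α * (t ^ (α * φ - 1 + α) * Real.exp (-lam ^ α * t ^ α))) := by
    intro t ht
    have ht' : 0 < t := ht
    rw [gwlPdf, mul_rpow hlam.le ht'.le, rpow_add ht', neg_mul]
    ring
  rw [setIntegral_congr_fun measurableSet_Ioi key, integral_const_mul,
    integral_add (i1.const_mul _) (i2.const_mul _), integral_const_mul, integral_const_mul,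
    e1, e2, hpow]
  have hbφ : 0 < (lam ^ α) ^ φ := rpow_pos_of_pos hb φ
  generalize (lam ^ α) ^ φ = c at *
  generalize lam ^ α = b at *
  have hs : lam + φ ≠ 0 := by positivity
  field_simp
end

section
/- Let φ > 0, λ > 0, α > 0. For every t > 0, the GWL density can be written as the two-component mixture f(t) = p·f₁(t) + (1 − p)·f₂(t), where p = λ/(λ + φ) and, for j = 1, 2, f_j(t) = (α/Γ(φ + j − 1)) λ^{α(φ+j−1)} t^{α(φ+j−1)−1} e^{−(λ t)^α} is the density of the generalized gamma distribution with shape φ + j − 1, rate λ and power α. -/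
open MeasureTheory Real

/-- The probability density function of the generalized gamma distribution with
shape `k`, rate `lam` and power `α`. -/
noncomputable def genGammaPdf (k lam α t : ℝ) : ℝ :=
  (α / Real.Gamma k) * lam ^ (α * k) * t ^ (α * k - 1) * Real.exp (-(lam * t) ^ α)

theorem gwl_pdf_mixture (φ lam α : ℝ) (hφ : 0 < φ) (hlam : 0 < lam) (hα : 0 < α) :
    ∀ t : ℝ, 0 < t →
      gwlPdf φ lam α t =
        (lam / (lam + φ)) * genGammaPdf φ lam α t +
          (1 - lam / (lam + φ)) * genGammaPdf (φ + 1) lam α t := by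
  intro t ht
  unfold gwlPdf genGammaPdf
  have hG : Real.Gamma φ ≠ 0 := (Real.Gamma_pos_of_pos hφ).ne'
  have hs : lam + φ ≠ 0 := by positivity
  have h1 : lam ^ (α * (φ + 1)) = lam ^ (α * φ) * lam ^ α := by
    rw [← Real.rpow_add hlam]; ring_nf
  have h2 : t ^ (α * (φ + 1) - 1) = t ^ (α * φ - 1) * t ^ α := by
    rw [← Real.rpow_add ht]; ring_nf
  have hp : 1 - lam / (lam + φ) = φ / (lam + φ) := by
    field_simp
    ring
  rw [Real.Gamma_add_one hφ.ne', h1, h2, hp]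
  generalize Real.exp (-(lam * t) ^ α) = E
  rw [Real.mul_rpow hlam.le ht.le]
  generalize t ^ (α * φ - 1) = A
  generalize lam ^ (α * φ) = B
  generalize lam ^ α = C
  generalize t ^ α = D
  have hφ' := hφ.ne'
  field_simp
end

section
/- Let φ > 0, λ > 0, α > 0 and let f be the GWL density. For every t > 0, the cumulative distribution function satisfies ∫₀^t f(x) dx = [ γ(φ, (λ t)^α) (λ + φ) − (λ t)^{αφ} e^{−(λ t)^α} ] / ( (λ + φ) Γ(φ) ), where γ(s, x) = ∫₀^x w^{s−1} e^{−w} dw is the lower incomplete gamma function. -/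
open MeasureTheory Real

/-- The lower incomplete gamma function `γ(s, x) = ∫₀^x w^(s-1) e^(-w) dw`. -/
noncomputable def lowerIncGamma (s x : ℝ) : ℝ :=
  ∫ w in (0 : ℝ)..x, w ^ (s - 1) * Real.exp (-w)


theorem incGamma_intble (φ : ℝ) (hφ : 0 < φ) (a b : ℝ) :
    IntervalIntegrable (fun w : ℝ => w ^ (φ - 1) * Real.exp (-w)) volume a b := by
  apply IntervalIntegrable.mul_continuousOn
  · exact intervalIntegral.intervalIntegrable_rpow' (by linarith)
  · fun_prop

theorem incGamma_cont (φ : ℝ) (hφ : 0 < φ) : Continuous (lowerIncGamma φ) := by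
  unfold lowerIncGamma
  exact intervalIntegral.continuous_primitive (incGamma_intble φ hφ) 0

theorem incGamma_deriv (φ : ℝ) (hφ : 0 < φ) (y : ℝ) (hy : 0 < y) :
    HasDerivAt (lowerIncGamma φ) (y ^ (φ - 1) * Real.exp (-y)) y := by
  unfold lowerIncGamma
  apply intervalIntegral.integral_hasDerivAt_right (incGamma_intble φ hφ 0 y)
  · apply Measurable.stronglyMeasurable _ |>.stronglyMeasurableAtFilter
    fun_prop
  · apply ContinuousAt.mul
    · exact Real.continuousAt_rpow_const _ _ (Or.inl hy.ne')
    · fun_prop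

theorem gwl_cdf (φ lam α : ℝ) (hφ : 0 < φ) (hlam : 0 < lam) (hα : 0 < α) :
    ∀ t : ℝ, 0 < t →
      ∫ x in (0 : ℝ)..t, gwlPdf φ lam α x =
        (lowerIncGamma φ ((lam * t) ^ α) * (lam + φ) -
            (lam * t) ^ (α * φ) * Real.exp (-(lam * t) ^ α)) /
          ((lam + φ) * Real.Gamma φ) := by
  intro t ht
  have hG := Real.Gamma_pos_of_pos hφ
  set F : ℝ → ℝ := fun x => (lowerIncGamma φ ((lam * x) ^ α) * (lam + φ) -
            (lam * x) ^ (α * φ) * Real.exp (-(lam * x) ^ α)) /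
          ((lam + φ) * Real.Gamma φ) with hF
  have hc : Continuous F := by
    have h1 := incGamma_cont φ hφ
    have h2 : Continuous fun x : ℝ => (lam * x) ^ α :=
      (continuous_const.mul continuous_id).rpow_const fun _ => Or.inr hα.le
    have h3 : Continuous fun x : ℝ => (lam * x) ^ (α * φ) :=
      (continuous_const.mul continuous_id).rpow_const fun _ => Or.inr (by positivity)
    have h4 := h1.comp h2
    exact ((h4.mul continuous_const).sub (h3.mul (Real.continuous_exp.comp h2.neg))).div_const _
  have hd : ∀ x ∈ Set.Ioo 0 t, HasDerivAt F (gwlPdf φ lam α x) x := by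
    intro x hx
    have hx0 : 0 < x := hx.1
    have hl : 0 < lam * x := by positivity
    have hm : HasDerivAt (fun x : ℝ => lam * x) lam x := by
      simpa using (hasDerivAt_id x).const_mul lam
    have h2 := hm.rpow_const (p := α) (Or.inl hl.ne')
    have h3 := hm.rpow_const (p := α * φ) (Or.inl hl.ne')
    have h4 := (incGamma_deriv φ hφ ((lam * x) ^ α) (by positivity)).comp x h2
    have h5 := ((h4.mul_const (lam + φ)).sub (h3.mul h2.neg.exp)).div_const
      ((lam + φ) * Real.Gamma φ)
    refine h5.congr_deriv ?_
    unfold gwlPdf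
    congr 1
    have e1 : ((lam * x) ^ α) ^ (φ - 1) = (lam * x) ^ (α * φ) / (lam * x) ^ α := by
      rw [← Real.rpow_mul hl.le, mul_sub, mul_one, Real.rpow_sub hl]
    have e4 : lam ^ (α * φ) * x ^ (α * φ - 1) = (lam * x) ^ (α * φ) / x := by
      rw [Real.mul_rpow hlam.le hx0.le, Real.rpow_sub_one hx0.ne']; ring
    rw [e1, Real.rpow_sub_one hl.ne', Real.rpow_sub_one hl.ne', mul_assoc α, e4]
    have hu : (lam * x) ^ α ≠ 0 := by positivity
    simp only [Pi.neg_apply]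
    generalize (lam * x) ^ α = u at *
    generalize (lam * x) ^ (α * φ) = v at *
    field_simp
    ring
  have hn : ∀ x ∈ Set.Ioo 0 t, 0 ≤ gwlPdf φ lam α x := by
    intro x hx
    have hx0 : 0 < x := hx.1
    unfold gwlPdf
    positivity
  have hi : IntervalIntegrable (gwlPdf φ lam α) volume 0 t := by
    rw [intervalIntegrable_iff_integrableOn_Ioc_of_le ht.le]
    exact intervalIntegral.integrableOn_deriv_of_nonneg hc.continuousOn hd hn
  rw [intervalIntegral.integral_eq_sub_of_hasDerivAt_of_le ht.le hc.continuousOn hd hi]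
  have h0 : F 0 = 0 := by
    simp [hF, lowerIncGamma, Real.zero_rpow hα.ne', Real.zero_rpow (mul_pos hα hφ).ne']
  rw [h0, sub_zero]
end

section
/- Let φ > 0, λ > 0, α > 0 and let f be the GWL density. As t → 0⁺: if αφ < 1 then f(t) → +∞; if αφ = 1 then f(t) → α λ² / ((λ + φ) Γ(φ)); and if αφ > 1 then f(t) → 0. -/
open MeasureTheory Real Filter

theorem gwl_pdf_limit_at_zero (φ lam α : ℝ) (hφ : 0 < φ) (hlam : 0 < lam)
    (hα : 0 < α) :
    (α * φ < 1 →
      Tendsto (fun t => gwlPdf φ lam α t) (nhdsWithin 0 (Set.Ioi 0)) atTop) ∧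
    (α * φ = 1 →
      Tendsto (fun t => gwlPdf φ lam α t) (nhdsWithin 0 (Set.Ioi 0))
        (nhds (α * lam ^ 2 / ((lam + φ) * Real.Gamma φ)))) ∧
    (1 < α * φ →
      Tendsto (fun t => gwlPdf φ lam α t) (nhdsWithin 0 (Set.Ioi 0)) (nhds 0)) := by
  have hΓ := Real.Gamma_pos_of_pos hφ
  have hC : ContinuousAt (fun t : ℝ => α * lam ^ (α * φ) * (lam + (lam * t) ^ α) *
      Real.exp (-(lam * t) ^ α) / ((lam + φ) * Real.Gamma φ)) 0 := by
    have h1 : ContinuousAt (fun t : ℝ => (lam * t) ^ α) 0 :=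
      ContinuousAt.rpow_const (by fun_prop) (Or.inr hα.le)
    have h2 : ContinuousAt (fun t : ℝ => Real.exp (-(lam * t) ^ α)) 0 :=
      Real.continuous_exp.continuousAt.comp h1.neg
    exact ((continuousAt_const.mul (continuousAt_const.add h1)).mul h2).div_const _
  have hg : Tendsto (fun t : ℝ => α * lam ^ (α * φ) * (lam + (lam * t) ^ α) *
      Real.exp (-(lam * t) ^ α) / ((lam + φ) * Real.Gamma φ)) (nhdsWithin 0 (Set.Ioi 0))
      (nhds (α * lam ^ (α * φ) * lam / ((lam + φ) * Real.Gamma φ))) := by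
    have := hC.tendsto.mono_left (nhdsWithin_le_nhds (s := Set.Ioi 0))
    simpa [Real.zero_rpow hα.ne'] using this
  have hf : (fun t => gwlPdf φ lam α t) = fun t : ℝ => t ^ (α * φ - 1) *
      (α * lam ^ (α * φ) * (lam + (lam * t) ^ α) *
      Real.exp (-(lam * t) ^ α) / ((lam + φ) * Real.Gamma φ)) := by
    funext t
    unfold gwlPdf
    ring
  rw [hf]
  refine ⟨fun h => ?_, fun h => ?_, fun h => ?_⟩
  · refine Tendsto.atTop_mul_pos (by positivity) ?_ hg
    exact tendsto_rpow_neg_nhdsGT_zero (by linarith)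
  · simp only [h, sub_self, Real.rpow_zero, one_mul, Real.rpow_one] at hg ⊢
    convert hg using 2
    ring
  · have h1 : ContinuousAt (fun t : ℝ => t ^ (α * φ - 1)) 0 :=
      ContinuousAt.rpow_const (by fun_prop) (Or.inr (by linarith))
    have h2 := (h1.tendsto.mono_left (nhdsWithin_le_nhds (s := Set.Ioi 0))).mul hg
    rw [Real.zero_rpow (by linarith), zero_mul] at h2
    exact h2
end

section
/- Let φ > 0, λ > 0, α ≥ 1, and let f be the GWL density. For every real t with |t| < λ, the moment generating function exists and equals the convergent series M(t) = ∫₀^∞ e^{t x} f(x) dx = Σ_{r=0}^∞ (t^r / (λ^r r!)) · ( (r/α + φ + λ) Γ(r/α + φ) ) / ( (λ + φ) Γ(φ) ). -/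
open MeasureTheory Real

lemma gwl_aux_integrable (lam α : ℝ) (hlam : 0 < lam) (hα : 1 ≤ α)
    (t : ℝ) (ht : |t| < lam) (s : ℝ) (hs : -1 < s) :
    IntegrableOn (fun x => Real.exp (t * x) * (x ^ s * Real.exp (-(lam ^ α) * x ^ α)))
      (Set.Ioi 0) := by
  have hc : |t| / lam < 1 := (div_lt_one hlam).2 ht
  have hc0 : 0 ≤ |t| / lam := by positivity
  have hb : 0 < (1 - |t| / lam) * lam ^ α := mul_pos (by linarith) (rpow_pos_of_pos hlam _)
  have h := (integrableOn_rpow_mul_exp_neg_mul_rpow hs (by linarith : 0 < α) hb).const_mul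
    (Real.exp (|t| / lam))
  refine Integrable.mono' h ?_ ?_
  · exact Measurable.aestronglyMeasurable (by fun_prop)
  · refine (ae_restrict_iff' measurableSet_Ioi).2 (Filter.Eventually.of_forall fun x hx => ?_)
    have hx : 0 < x := hx
    have hxs : 0 < x ^ s := rpow_pos_of_pos hx _
    rw [Real.norm_of_nonneg (by positivity)]
    have key : t * x + (-(lam ^ α) * x ^ α)
        ≤ |t| / lam + (-((1 - |t| / lam) * lam ^ α) * x ^ α) := by
      have h1 : lam * x ≤ 1 + (lam * x) ^ α := by
        have hp : 0 < (lam * x) ^ α := by positivity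
        rcases le_total (lam * x) 1 with h | h
        · linarith
        · have := Real.self_le_rpow_of_one_le h hα
          linarith
      rw [mul_rpow hlam.le hx.le] at h1
      have h2 : t * x ≤ |t| / lam * (lam * x) := by
        rw [show |t| / lam * (lam * x) = |t| * x by field_simp]
        exact mul_le_mul_of_nonneg_right (le_abs_self t) hx.le
      have h3 := mul_le_mul_of_nonneg_left h1 hc0
      linarith
    have := Real.exp_le_exp.2 key
    rw [Real.exp_add, Real.exp_add] at this
    have := mul_le_mul_of_nonneg_left this hxs.le
    linarith

lemma gwl_aux_pdf (φ lam α x : ℝ) (hlam : 0 < lam) (hx : 0 < x) :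
    gwlPdf φ lam α x = α * lam ^ (α * φ) / ((lam + φ) * Real.Gamma φ) *
      (lam * (x ^ (α * φ - 1) * Real.exp (-(lam ^ α) * x ^ α)) +
        lam ^ α * (x ^ (α * φ + α - 1) * Real.exp (-(lam ^ α) * x ^ α))) := by
  unfold gwlPdf
  rw [mul_rpow hlam.le hx.le, show α * φ + α - 1 = (α * φ - 1) + α by ring, rpow_add hx, neg_mul]
  ring

lemma gwl_aux_mgf_integrable (φ lam α : ℝ) (hφ : 0 < φ) (hlam : 0 < lam) (hα : 1 ≤ α)
    (t : ℝ) (ht : |t| < lam) :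
    IntegrableOn (fun x => Real.exp (t * x) * gwlPdf φ lam α x) (Set.Ioi 0) := by
  have hαφ : 0 < α * φ := mul_pos (by linarith) hφ
  have h1 := gwl_aux_integrable lam α hlam hα t ht (α * φ - 1) (by linarith)
  have h2 := gwl_aux_integrable lam α hlam hα t ht (α * φ + α - 1) (by linarith)
  have h3 := ((h1.const_mul lam).add (h2.const_mul (lam ^ α))).const_mul
    (α * lam ^ (α * φ) / ((lam + φ) * Real.Gamma φ))
  refine IntegrableOn.congr_fun h3 (fun x hx => ?_) measurableSet_Ioi
  simp only [gwl_aux_pdf φ lam α x hlam hx, Pi.add_apply]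
  ring

lemma gwl_aux_moment (φ lam α : ℝ) (hφ : 0 < φ) (hlam : 0 < lam) (hα : 1 ≤ α) (t : ℝ) (r : ℕ) :
    ∫ x in Set.Ioi (0 : ℝ), (t * x) ^ r / (Nat.factorial r : ℝ) * gwlPdf φ lam α x =
      t ^ r / (lam ^ r * (Nat.factorial r : ℝ)) *
        (((r : ℝ) / α + φ + lam) * Real.Gamma ((r : ℝ) / α + φ)) /
          ((lam + φ) * Real.Gamma φ) := by
  have hα0 : 0 < α := by linarith
  have hαφ : 0 < α * φ := mul_pos hα0 hφ
  have hr : (0 : ℝ) ≤ r := Nat.cast_nonneg r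
  have hb : 0 < lam ^ α := rpow_pos_of_pos hlam _
  have hq1 : -1 < r + (α * φ - 1) := by linarith
  have hq2 : -1 < r + (α * φ + α - 1) := by linarith
  have i1 := (integrableOn_rpow_mul_exp_neg_mul_rpow hq1 hα0 hb)
  have i2 := (integrableOn_rpow_mul_exp_neg_mul_rpow hq2 hα0 hb)
  have e : ∫ x in Set.Ioi (0 : ℝ), (t * x) ^ r / (Nat.factorial r : ℝ) * gwlPdf φ lam α x =
      ∫ x in Set.Ioi (0 : ℝ), (t ^ r / (Nat.factorial r : ℝ) *
        (α * lam ^ (α * φ) / ((lam + φ) * Real.Gamma φ))) *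
      (lam * (x ^ (r + (α * φ - 1)) * Real.exp (-(lam ^ α) * x ^ α)) +
        lam ^ α * (x ^ (r + (α * φ + α - 1)) * Real.exp (-(lam ^ α) * x ^ α))) := by
    refine setIntegral_congr_fun measurableSet_Ioi (fun x hx => ?_)
    simp only [gwl_aux_pdf φ lam α x hlam hx]
    rw [rpow_add hx, rpow_add hx, rpow_natCast, mul_pow]
    ring
  rw [e, integral_const_mul, integral_add (i1.const_mul _) (i2.const_mul _), integral_const_mul,
    integral_const_mul, integral_rpow_mul_exp_neg_mul_rpow hα0 hq1 hb,
    integral_rpow_mul_exp_neg_mul_rpow hα0 hq2 hb, ← rpow_mul hlam.le, ← rpow_mul hlam.le]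
  have g0 : (r + (α * φ - 1) + 1) / α = r / α + φ := by field_simp; ring
  have g1 : (r + (α * φ + α - 1) + 1) / α = r / α + φ + 1 := by field_simp; ring
  have g2 : α * (-(r + (α * φ - 1) + 1) / α) = -(r : ℝ) + -(α * φ) := by field_simp; ring
  have g3 : α * (-(r + (α * φ + α - 1) + 1) / α) = -(r : ℝ) + -(α * φ) + -α := by
    field_simp; ring
  have hpos : 0 < r / α + φ := by positivity
  rw [g0, g1, g2, g3, Real.Gamma_add_one hpos.ne', rpow_add hlam, rpow_add hlam, rpow_add hlam,
    rpow_neg hlam.le, rpow_neg hlam.le, rpow_neg hlam.le, rpow_natCast]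
  have hG : Real.Gamma φ ≠ 0 := (Real.Gamma_pos_of_pos hφ).ne'
  have hA : lam ^ (α * φ) ≠ 0 := (rpow_pos_of_pos hlam _).ne'
  have hs : lam + φ ≠ 0 := by positivity
  have hb' := hb.ne'
  generalize Real.Gamma (r / α + φ) = G
  generalize lam ^ (α * φ) = A at *
  generalize lam ^ α = B at *
  field_simp
  ring

theorem gwl_mgf (φ lam α : ℝ) (hφ : 0 < φ) (hlam : 0 < lam) (hα : 1 ≤ α)
    (t : ℝ) (ht : |t| < lam) :
    IntegrableOn (fun x => Real.exp (t * x) * gwlPdf φ lam α x) (Set.Ioi 0) ∧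
    Summable (fun r : ℕ =>
      t ^ r / (lam ^ r * (Nat.factorial r : ℝ)) *
        (((r : ℝ) / α + φ + lam) * Real.Gamma ((r : ℝ) / α + φ)) /
          ((lam + φ) * Real.Gamma φ)) ∧
    ∫ x in Set.Ioi (0 : ℝ), Real.exp (t * x) * gwlPdf φ lam α x =
      ∑' r : ℕ,
        t ^ r / (lam ^ r * (Nat.factorial r : ℝ)) *
          (((r : ℝ) / α + φ + lam) * Real.Gamma ((r : ℝ) / α + φ)) /
            ((lam + φ) * Real.Gamma φ) := by
  have hint := gwl_aux_mgf_integrable φ lam α hφ hlam hα t ht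
  have hint' := gwl_aux_mgf_integrable φ lam α hφ hlam hα |t| (by rwa [abs_abs])
  have hexp : ∀ y : ℝ, HasSum (fun n : ℕ => y ^ n / (Nat.factorial n : ℝ)) (Real.exp y) := by
    intro y
    rw [Real.exp_eq_exp_ℝ]
    exact NormedSpace.expSeries_div_hasSum_exp y
  have hmeas : Measurable (gwlPdf φ lam α) := by
    unfold gwlPdf
    fun_prop
  have hsum : HasSum
      (fun r : ℕ => ∫ x in Set.Ioi (0 : ℝ), (t * x) ^ r / (Nat.factorial r : ℝ) * gwlPdf φ lam α x)
      (∫ x in Set.Ioi (0 : ℝ), Real.exp (t * x) * gwlPdf φ lam α x) := by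
    refine hasSum_integral_of_dominated_convergence
      (fun r x => (|t| * x) ^ r / (Nat.factorial r : ℝ) * gwlPdf φ lam α x) ?_ ?_ ?_ ?_ ?_
    · intro n
      exact Measurable.aestronglyMeasurable (by fun_prop)
    · intro n
      refine (ae_restrict_iff' measurableSet_Ioi).2 (Filter.Eventually.of_forall fun x hx => ?_)
      have hx : 0 < x := hx
      have hp : 0 ≤ gwlPdf φ lam α x := by
        have := Real.Gamma_pos_of_pos hφ
        unfold gwlPdf
        positivity
      rw [norm_mul, norm_div, norm_pow, norm_mul, Real.norm_of_nonneg hp, Real.norm_eq_abs t,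
        Real.norm_of_nonneg hx.le, Real.norm_of_nonneg (Nat.cast_nonneg _)]
    · exact Filter.Eventually.of_forall fun x => ((hexp (|t| * x)).mul_right _).summable
    · have : (fun x => ∑' n : ℕ, (|t| * x) ^ n / (Nat.factorial n : ℝ) * gwlPdf φ lam α x)
          = fun x => Real.exp (|t| * x) * gwlPdf φ lam α x := by
        funext x
        exact ((hexp (|t| * x)).mul_right _).tsum_eq
      rw [this]
      exact hint'
    · exact Filter.Eventually.of_forall fun x => (hexp (t * x)).mul_right _
  simp only [gwl_aux_moment φ lam α hφ hlam hα t] at hsum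
  exact ⟨hint, hsum.summable, hsum.tsum_eq.symm⟩
end

section
/- Let φ > 0, λ > 0, α > 0 and let f be the GWL density. For every real r ≥ 0, the r-th moment of the distribution is ∫₀^∞ t^r f(t) dt = ( (r/α + φ + λ) Γ(r/α + φ) ) / ( (λ + φ) λ^r Γ(φ) ). -/
open MeasureTheory Real

theorem gwl_moment (φ lam α : ℝ) (hφ : 0 < φ) (hlam : 0 < lam) (hα : 0 < α)
    (r : ℝ) (hr : 0 ≤ r) :
    ∫ t in Set.Ioi (0 : ℝ), t ^ r * gwlPdf φ lam α t =
      ((r / α + φ + lam) * Real.Gamma (r / α + φ)) /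
        ((lam + φ) * lam ^ r * Real.Gamma φ) := by
  have hb : 0 < lam ^ α := rpow_pos_of_pos hlam _
  have hαφ : 0 < α * φ := mul_pos hα hφ
  have hq1 : -1 < r + α * φ - 1 := by linarith
  have hq2 : -1 < r + α * φ + α - 1 := by linarith
  have hG : 0 < Real.Gamma φ := Real.Gamma_pos_of_pos hφ
  have hs : 0 < r / α + φ := by positivity
  have key : ∀ t ∈ Set.Ioi (0 : ℝ), t ^ r * gwlPdf φ lam α t =
      (α * lam ^ (α * φ) * lam / ((lam + φ) * Real.Gamma φ)) *
        (t ^ (r + α * φ - 1) * Real.exp (-lam ^ α * t ^ α)) +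
      (α * lam ^ (α * φ) * lam ^ α / ((lam + φ) * Real.Gamma φ)) *
        (t ^ (r + α * φ + α - 1) * Real.exp (-lam ^ α * t ^ α)) := by
    intro t ht
    have ht' : 0 < t := ht
    have e1 : t ^ (r + α * φ - 1) = t ^ r * t ^ (α * φ - 1) := by
      rw [← rpow_add ht']; congr 1; ring
    have e2 : t ^ (r + α * φ + α - 1) = t ^ r * t ^ (α * φ - 1) * t ^ α := by
      rw [← rpow_add ht', ← rpow_add ht']; congr 1; ring
    rw [gwlPdf, mul_rpow hlam.le ht'.le, e1, e2, neg_mul]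
    ring
  rw [setIntegral_congr_fun measurableSet_Ioi key, integral_add
    ((integrableOn_rpow_mul_exp_neg_mul_rpow hq1 hα hb).const_mul _)
    ((integrableOn_rpow_mul_exp_neg_mul_rpow hq2 hα hb).const_mul _),
    integral_const_mul, integral_const_mul,
    integral_rpow_mul_exp_neg_mul_rpow hα hq1 hb,
    integral_rpow_mul_exp_neg_mul_rpow hα hq2 hb, ← rpow_mul hlam.le, ← rpow_mul hlam.le]
  have g1 : (r + α * φ - 1 + 1) / α = r / α + φ := by field_simp; ring
  have g2 : (r + α * φ + α - 1 + 1) / α = r / α + φ + 1 := by field_simp; ring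
  have x1 : α * (-(r + α * φ - 1 + 1) / α) = -(r + α * φ) := by field_simp; ring
  have x2 : α * (-(r + α * φ + α - 1 + 1) / α) = -(r + α * φ + α) := by field_simp; ring
  rw [g1, g2, x1, x2, Real.Gamma_add_one hs.ne', rpow_neg hlam.le, rpow_neg hlam.le,
    rpow_add hlam, rpow_add hlam, rpow_add hlam]
  have hr' : 0 < lam ^ r := rpow_pos_of_pos hlam _
  have hc : 0 < lam ^ (α * φ) := rpow_pos_of_pos hlam _
  have hlp : 0 < lam + φ := by positivity
  generalize Real.Gamma (r / α + φ) = G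
  generalize r / α + φ = s
  field_simp
  ring
end

section
/- Let φ > 0, λ > 0, α > 0 and let f be the GWL density. The mean of the distribution is ∫₀^∞ t f(t) dt = ( (1/α + φ + λ) Γ(1/α + φ) ) / ( λ (λ + φ) Γ(φ) ). -/
open MeasureTheory Real

theorem gwl_mean (φ lam α : ℝ) (hφ : 0 < φ) (hlam : 0 < lam) (hα : 0 < α) :
    ∫ t in Set.Ioi (0 : ℝ), t * gwlPdf φ lam α t =
      ((1 / α + φ + lam) * Real.Gamma (1 / α + φ)) /
        (lam * (lam + φ) * Real.Gamma φ) := by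
  have hb : 0 < lam ^ α := rpow_pos_of_pos hlam _
  have hp : 0 < α * φ := mul_pos hα hφ
  have h1 : (-1 : ℝ) < α * φ := by linarith
  have h2 : (-1 : ℝ) < α * φ + α := by linarith
  have hG : Real.Gamma φ ≠ 0 := (Real.Gamma_pos_of_pos hφ).ne'
  have hs : lam + φ ≠ 0 := by positivity
  have key : ∀ t ∈ Set.Ioi (0 : ℝ), t * gwlPdf φ lam α t =
      α * lam ^ (α * φ) * lam / ((lam + φ) * Real.Gamma φ) *
        (t ^ (α * φ) * Real.exp (-lam ^ α * t ^ α)) +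
      α * lam ^ (α * φ) * lam ^ α / ((lam + φ) * Real.Gamma φ) *
        (t ^ (α * φ + α) * Real.exp (-lam ^ α * t ^ α)) := by
    intro t ht
    have ht : 0 < t := ht
    unfold gwlPdf
    rw [rpow_sub_one ht.ne', mul_rpow hlam.le ht.le, rpow_add ht, neg_mul]
    field_simp
  rw [setIntegral_congr_fun measurableSet_Ioi key, integral_add
    ((integrableOn_rpow_mul_exp_neg_mul_rpow h1 hα hb).const_mul _)
    ((integrableOn_rpow_mul_exp_neg_mul_rpow h2 hα hb).const_mul _),
    integral_const_mul, integral_const_mul,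
    integral_rpow_mul_exp_neg_mul_rpow hα h1 hb,
    integral_rpow_mul_exp_neg_mul_rpow hα h2 hb]
  have e1 : (α * φ + 1) / α = 1 / α + φ := by field_simp; ring
  have e2 : (α * φ + α + 1) / α = (1 / α + φ) + 1 := by field_simp; ring
  have e3 : (lam ^ α) ^ (-(α * φ + 1) / α) = (lam ^ (α * φ))⁻¹ * lam⁻¹ := by
    rw [← rpow_mul hlam.le, mul_div_cancel₀ _ hα.ne', rpow_neg hlam.le,
      rpow_add hlam, rpow_one, mul_inv]
  have e4 : (lam ^ α) ^ (-(α * φ + α + 1) / α) =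
      (lam ^ (α * φ))⁻¹ * (lam ^ α)⁻¹ * lam⁻¹ := by
    rw [← rpow_mul hlam.le, mul_div_cancel₀ _ hα.ne', rpow_neg hlam.le,
      rpow_add hlam, rpow_add hlam, rpow_one, mul_inv, mul_inv]
  have hq : 1 / α + φ ≠ 0 := by positivity
  rw [e3, e4, e1, e2, Real.Gamma_add_one hq]
  have hc : lam ^ (α * φ) ≠ 0 := (rpow_pos_of_pos hlam _).ne'
  generalize Real.Gamma (1 / α + φ) = G
  generalize lam ^ (α * φ) = c at *
  generalize lam ^ α = b at *
  have hb' := hb.ne'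
  field_simp
  ring
end

section
/- Let φ > 0, λ > 0, α > 0 and let f be the GWL density. Then ∫₀^∞ (log t) f(t) dt = ( ψ(φ) − α log λ + 1/(λ + φ) ) / α, where ψ = Γ′/Γ is the digamma function. -/
open MeasureTheory Real

/-- The digamma function `ψ = Γ'/Γ`. -/
noncomputable def digamma (x : ℝ) : ℝ := deriv Real.Gamma x / Real.Gamma x

open Filter Topology Asymptotics in
theorem gamma_log_aux (s : ℝ) (hs : 0 < s) :
    IntegrableOn (fun y : ℝ => Real.log y * (y ^ (s - 1) * Real.exp (-y))) (Set.Ioi 0) ∧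
    ∫ y in Set.Ioi (0 : ℝ), Real.log y * (y ^ (s - 1) * Real.exp (-y)) = deriv Real.Gamma s := by
  have hs' : 0 < (s : ℂ).re := by simpa using hs
  have key := mellin_hasDerivAt_of_isBigO_rpow (E := ℂ) (a := (s : ℂ).re + 1) (b := 0)
    (f := fun x : ℝ => ((Real.exp (-x) : ℝ) : ℂ)) (s := (s : ℂ))
    (by
      refine (Continuous.continuousOn ?_).locallyIntegrableOn measurableSet_Ioi
      exact Complex.continuous_ofReal.comp (Real.continuous_exp.comp continuous_neg))
    (by
      rw [← isBigO_norm_left]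
      simp_rw [Complex.norm_real, isBigO_norm_left]
      simpa only [neg_one_mul] using (isLittleO_exp_neg_mul_rpow_atTop zero_lt_one _).isBigO)
    (lt_add_one _)
    (by
      simp_rw [neg_zero, rpow_zero]
      refine isBigO_const_of_tendsto (?_ : Tendsto _ _ (𝓝 (1 : ℂ))) one_ne_zero
      rw [(by simp : (1 : ℂ) = Real.exp (-0))]
      exact (Complex.continuous_ofReal.comp
        (Real.continuous_exp.comp continuous_neg)).continuousWithinAt) hs'
  obtain ⟨h1, h2⟩ := key
  have hfun : ∀ t ∈ Set.Ioi (0 : ℝ),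
      (t : ℂ) ^ ((s : ℂ) - 1) • (Real.log t • ((Real.exp (-t) : ℝ) : ℂ)) =
      ((Real.log t * (t ^ (s - 1) * Real.exp (-t)) : ℝ) : ℂ) := by
    intro t ht
    have ht' : (0 : ℝ) ≤ t := le_of_lt ht
    rw [Complex.real_smul, smul_eq_mul]
    push_cast [Complex.ofReal_cpow ht']
    ring
  constructor
  · have h3 := (integrableOn_congr_fun hfun measurableSet_Ioi).1 h1
    have h4 := h3.re
    simpa only [RCLike.re_eq_complex_re, Complex.ofReal_re] using! h4
  · rw [← Complex.GammaIntegral_eq_mellin] at h2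
    have h5 : HasDerivAt Complex.Gamma (mellin (fun t : ℝ => Real.log t • ((Real.exp (-t) : ℝ) : ℂ)) s) (s : ℂ) := by
      refine h2.congr_of_eventuallyEq ?_
      have : IsOpen {s : ℂ | 0 < s.re} := Complex.continuous_re.isOpen_preimage _ isOpen_Ioi
      filter_upwards [this.mem_nhds hs'] with a ha using Complex.Gamma_eq_integral ha
    have h6 := h5.real_of_complex
    have h7 : mellin (fun t : ℝ => Real.log t • ((Real.exp (-t) : ℝ) : ℂ)) s =
        ((∫ y in Set.Ioi (0 : ℝ), Real.log y * (y ^ (s - 1) * Real.exp (-y)) : ℝ) : ℂ) := by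
      rw [mellin, setIntegral_congr_fun measurableSet_Ioi hfun]
      exact integral_ofReal
    rw [h7] at h6
    have h8 : HasDerivAt Real.Gamma
        (∫ y in Set.Ioi (0 : ℝ), Real.log y * (y ^ (s - 1) * Real.exp (-y))) s := by
      simpa [Complex.Gamma_ofReal] using h6
    exact h8.deriv.symm

theorem deriv_gamma_add_one_aux (s : ℝ) (hs : 0 < s) :
    deriv Real.Gamma (s + 1) = Real.Gamma s + s * deriv Real.Gamma s := by
  have hd : DifferentiableAt ℝ Real.Gamma s := Real.differentiableAt_Gamma (fun m => by
    have : (0 : ℝ) ≤ m := Nat.cast_nonneg m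
    linarith)
  have h1 : HasDerivAt (fun x : ℝ => x * Real.Gamma x)
      (1 * Real.Gamma s + s * deriv Real.Gamma s) s := (hasDerivAt_id s).mul hd.hasDerivAt
  have h2 : HasDerivAt (fun x : ℝ => Real.Gamma (x + 1))
      (1 * Real.Gamma s + s * deriv Real.Gamma s) s := by
    refine h1.congr_of_eventuallyEq ?_
    filter_upwards [lt_mem_nhds hs] with x hx using Real.Gamma_add_one hx.ne'
  rw [← deriv_comp_add_const, h2.deriv, one_mul]

theorem gwl_log_moment (φ lam α : ℝ) (hφ : 0 < φ) (hlam : 0 < lam) (hα : 0 < α) :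
    ∫ t in Set.Ioi (0 : ℝ), Real.log t * gwlPdf φ lam α t =
      (digamma φ - α * Real.log lam + 1 / (lam + φ)) / α := by
  have hG : 0 < Real.Gamma φ := Real.Gamma_pos_of_pos hφ
  have hlp : 0 < lam + φ := by positivity
  obtain ⟨i1, e1⟩ := gamma_log_aux φ hφ
  obtain ⟨i2, e2⟩ := gamma_log_aux (φ + 1) (by positivity)
  have i3 := Real.GammaIntegral_convergent hφ
  have i4 := Real.GammaIntegral_convergent (s := φ + 1) (by positivity)
  have e3 := Real.Gamma_eq_integral hφ
  have e4 := Real.Gamma_eq_integral (s := φ + 1) (by positivity)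
  set C := (lam + φ) * Real.Gamma φ with hC
  have hC0 : 0 < C := by positivity
  let G : ℝ → ℝ := fun y => (Real.log y / α - Real.log lam) *
    (y ^ (φ - 1) * (lam + y) * Real.exp (-y)) / C
  let H : ℝ → ℝ := fun x => (α * x ^ (α - 1)) • G (x ^ α)
  have s1 : ∫ x in Set.Ioi (0 : ℝ), H x = ∫ y in Set.Ioi (0 : ℝ), G y :=
    integral_comp_rpow_Ioi_of_pos hα
  have s2 : ∫ t in Set.Ioi (0 : ℝ), lam * H (lam * t) = ∫ y in Set.Ioi (0 : ℝ), G y := by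
    rw [integral_const_mul, integral_comp_mul_left_Ioi _ _ hlam, mul_zero, s1, smul_eq_mul,
      mul_inv_cancel_left₀ hlam.ne']
  have s3 : ∫ t in Set.Ioi (0 : ℝ), Real.log t * gwlPdf φ lam α t =
      ∫ t in Set.Ioi (0 : ℝ), lam * H (lam * t) := by
    refine setIntegral_congr_fun measurableSet_Ioi (fun t ht => ?_)
    have ht : 0 < t := ht
    have hlt : 0 < lam * t := by positivity
    have l1 : Real.log ((lam * t) ^ α) / α - Real.log lam = Real.log t := by
      rw [Real.log_rpow hlt, Real.log_mul hlam.ne' ht.ne']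
      field_simp
      ring
    have l2 : lam * ((lam * t) ^ (α - 1) * ((lam * t) ^ α) ^ (φ - 1)) =
        lam ^ (α * φ) * t ^ (α * φ - 1) := by
      rw [← Real.rpow_mul hlt.le, ← Real.rpow_add hlt, Real.mul_rpow hlam.le ht.le,
        show α - 1 + α * (φ - 1) = α * φ - 1 by ring, Real.rpow_sub_one hlam.ne']
      field_simp
    simp only [H, G, gwlPdf, smul_eq_mul, l1, ← hC]
    linear_combination (-(Real.log t * α * (lam + (lam * t) ^ α) *
      Real.exp (-(lam * t) ^ α) / C)) * l2
  rw [s3, s2]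
  have s4 : ∫ y in Set.Ioi (0 : ℝ), G y = ∫ y in Set.Ioi (0 : ℝ),
      ((lam / (α * C) * (Real.log y * (y ^ (φ - 1) * Real.exp (-y))) +
       1 / (α * C) * (Real.log y * (y ^ (φ + 1 - 1) * Real.exp (-y)))) -
      (Real.log lam * lam / C * (Real.exp (-y) * y ^ (φ - 1)) +
       Real.log lam / C * (Real.exp (-y) * y ^ (φ + 1 - 1)))) := by
    refine setIntegral_congr_fun measurableSet_Ioi (fun y hy => ?_)
    have hy : 0 < y := hy
    have : y ^ (φ + 1 - 1) = y ^ (φ - 1) * y := by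
      rw [Real.rpow_sub_one hy.ne' φ, add_sub_cancel_right]
      field_simp
    simp only [G, this]
    field_simp
  rw [s4, integral_sub (by exact (i1.const_mul _).add (i2.const_mul _))
      (by exact (i3.const_mul _).add (i4.const_mul _)),
    integral_add (i1.const_mul _) (i2.const_mul _),
    integral_add (i3.const_mul _) (i4.const_mul _)]
  simp only [integral_const_mul]
  rw [e1, e2, ← e3, ← e4, deriv_gamma_add_one_aux φ hφ, Real.Gamma_add_one hφ.ne', digamma, hC]
  field_simp
  ring
end

section
/- Let φ > 0, λ > 0, α > 0 and let f be the GWL density. For every t > 0, the survival function S(t) = ∫_t^∞ f(x) dx satisfies S(t) = [ Γ(φ, (λ t)^α) (λ + φ) + (λ t)^{αφ} e^{−(λ t)^α} ] / ( (λ + φ) Γ(φ) ), where Γ(s, x) = ∫_x^∞ w^{s−1} e^{−w} dw is the upper incomplete gamma function. -/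
open MeasureTheory Real

/-- The upper incomplete gamma function `Γ(s, x) = ∫_x^∞ w^(s-1) e^(-w) dw`. -/
noncomputable def upperIncGamma (s x : ℝ) : ℝ :=
  ∫ w in Set.Ioi x, w ^ (s - 1) * Real.exp (-w)

theorem upperIncGamma_aux (φ c : ℝ) (hφ : 0 < φ) (hc : 0 < c) :
    IntegrableOn (fun w : ℝ => w ^ (φ - 1) * Real.exp (-w)) (Set.Ioi c) := by
  have h := (Real.GammaIntegral_convergent hφ).mono_set (Set.Ioi_subset_Ioi hc.le)
  refine h.congr_fun (fun x _ => ?_) measurableSet_Ioi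
  simp only [mul_comm]

theorem upperIncGamma_rec (φ c : ℝ) (hφ : 0 < φ) (hc : 0 < c) :
    ∫ w in Set.Ioi c, (w ^ φ * Real.exp (-w) - φ * (w ^ (φ - 1) * Real.exp (-w))) =
      c ^ φ * Real.exp (-c) := by
  have h1 := upperIncGamma_aux φ c hφ hc
  have h2 := upperIncGamma_aux (φ + 1) c (by linarith) hc
  simp only [add_sub_cancel_right] at h2
  have hd : ∀ x ∈ Set.Ici c, HasDerivAt (fun w : ℝ => -(w ^ φ * Real.exp (-w)))
      (x ^ φ * Real.exp (-x) - φ * (x ^ (φ - 1) * Real.exp (-x))) x := by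
    intro x hx
    have hx0 : x ≠ 0 := (lt_of_lt_of_le hc hx).ne'
    have := ((Real.hasDerivAt_rpow_const (p := φ) (Or.inl hx0)).mul
      ((hasDerivAt_neg x).exp)).neg
    convert! this using 1
    ring
  have ht : Filter.Tendsto (fun w : ℝ => -(w ^ φ * Real.exp (-w))) Filter.atTop (nhds 0) := by
    have := (tendsto_rpow_mul_exp_neg_mul_atTop_nhds_zero φ 1 one_pos).neg
    simpa using this
  rw [integral_Ioi_of_hasDerivAt_of_tendsto' hd (h2.sub (h1.const_mul φ)) ht]
  ring

theorem gwl_survival (φ lam α : ℝ) (hφ : 0 < φ) (hlam : 0 < lam) (hα : 0 < α) :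
    ∀ t : ℝ, 0 < t →
      ∫ x in Set.Ioi t, gwlPdf φ lam α x =
        (upperIncGamma φ ((lam * t) ^ α) * (lam + φ) +
            (lam * t) ^ (α * φ) * Real.exp (-(lam * t) ^ α)) /
          ((lam + φ) * Real.Gamma φ) := by
  intro t ht
  have hlt : 0 < lam * t := mul_pos hlam ht
  have hc : 0 < (lam * t) ^ α := rpow_pos_of_pos hlt α
  have h1 := upperIncGamma_aux φ _ hφ hc
  have h2 := upperIncGamma_aux (φ + 1) _ (by linarith) hc
  simp only [add_sub_cancel_right] at h2
  set G : ℝ → ℝ := fun w => (lam + φ) * (w ^ (φ - 1) * Real.exp (-w)) +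
    (w ^ φ * Real.exp (-w) - φ * (w ^ (φ - 1) * Real.exp (-w))) with hG
  have hGint : ∫ w in Set.Ioi ((lam * t) ^ α), G w =
      (lam + φ) * upperIncGamma φ ((lam * t) ^ α) +
        ((lam * t) ^ α) ^ φ * Real.exp (-(lam * t) ^ α) := by
    have hadd := integral_add (h1.const_mul (lam + φ)) (h2.sub (h1.const_mul φ))
    simp only [Pi.sub_apply] at hadd
    rw [upperIncGamma_rec φ _ hφ hc, integral_const_mul] at hadd
    exact hadd
  have e1 := integral_comp_rpow_Ioi_of_pos' (g := G) hα hc.le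
  rw [Real.rpow_rpow_inv hlt.le hα.ne'] at e1
  have e2 := integral_comp_mul_left_Ioi' (fun x : ℝ => (α * x ^ (α - 1)) • G (x ^ α)) t hlam
  rw [e1, hGint] at e2
  rw [Real.rpow_mul hlt.le, mul_comm (upperIncGamma _ _), ← e2, smul_eq_mul,
    ← integral_const_mul, ← integral_div]
  refine setIntegral_congr_fun measurableSet_Ioi (fun x hx => ?_)
  have hx0 : 0 < x := lt_trans ht hx
  have hlx : 0 < lam * x := mul_pos hlam hx0
  have hw : 0 < (lam * x) ^ α := rpow_pos_of_pos hlx α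
  have k1 : ((lam * x) ^ α) ^ φ = (lam * x) ^ α * ((lam * x) ^ α) ^ (φ - 1) := by
    rw [Real.rpow_sub_one hw.ne']; field_simp
  have k2 : lam ^ (α * φ) * x ^ (α * φ - 1) =
      lam * ((lam * x) ^ (α - 1) * ((lam * x) ^ α) ^ (φ - 1)) := by
    rw [← Real.rpow_mul hlx.le, ← Real.rpow_add hlx,
      show α - 1 + α * (φ - 1) = α * φ - 1 by ring, Real.mul_rpow hlam.le hx0.le,
      Real.rpow_sub_one hlam.ne']
    field_simp
  simp only [gwlPdf, hG, smul_eq_mul]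
  rw [k1, mul_assoc α, k2]
  ring
end

section
/- Let φ ≥ 1, λ > 0 and α = 1, and let f be the corresponding GWL density (i.e., the weighted Lindley density f(t) = λ^{φ+1} t^{φ−1} (1 + t) e^{−λ t} / ((λ + φ) Γ(φ))). Then the hazard function h(t) = f(t) / ∫_t^∞ f(x) dx is increasing on (0, ∞): for all 0 < t₁ ≤ t₂, h(t₁) ≤ h(t₂). -/
open MeasureTheory Real

/-- The weighted Lindley probability density function (GWL density with `α = 1`). -/
noncomputable def wlPdf (φ lam t : ℝ) : ℝ :=
  lam ^ (φ + 1) * t ^ (φ - 1) * (1 + t) * Real.exp (-(lam * t)) /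
    ((lam + φ) * Real.Gamma φ)

/-- The hazard function of the weighted Lindley distribution. -/
noncomputable def wlHazard (φ lam t : ℝ) : ℝ :=
  wlPdf φ lam t / ∫ x in Set.Ioi t, wlPdf φ lam x


lemma wlPdf_pos (φ lam : ℝ) (hφ : 1 ≤ φ) (hlam : 0 < lam) (t : ℝ) (ht : 0 < t) :
    0 < wlPdf φ lam t := by
  unfold wlPdf
  have := Real.Gamma_pos_of_pos (show 0 < φ by linarith)
  positivity

lemma wlPdf_int (φ lam : ℝ) (hφ : 1 ≤ φ) (hlam : 0 < lam) (t : ℝ) (ht : 0 < t) :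
    IntegrableOn (wlPdf φ lam) (Set.Ioi t) := by
  have h1 := integrableOn_rpow_mul_exp_neg_mul_rpow (p := 1) (s := φ - 1) (b := lam)
    (by linarith) one_pos hlam
  have h2 := integrableOn_rpow_mul_exp_neg_mul_rpow (p := 1) (s := φ) (b := lam)
    (by linarith) one_pos hlam
  have h3 := (Integrable.add h1 h2).const_mul (lam ^ (φ + 1) / ((lam + φ) * Real.Gamma φ))
  have h4 : IntegrableOn (wlPdf φ lam) (Set.Ioi 0) := by
    refine IntegrableOn.congr_fun h3 ?_ measurableSet_Ioi
    intro x hx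
    have hx : 0 < x := hx
    have e : x ^ φ = x ^ (φ - 1) * x := by
      rw [← Real.rpow_add_one hx.ne']; congr 1; ring
    simp only [wlPdf, Pi.add_apply, Real.rpow_one, e, neg_mul]
    ring
  exact h4.mono_set (Set.Ioi_subset_Ioi ht.le)

lemma wlS_pos (φ lam : ℝ) (hφ : 1 ≤ φ) (hlam : 0 < lam) (t : ℝ) (ht : 0 < t) :
    0 < ∫ x in Set.Ioi t, wlPdf φ lam x := by
  rw [setIntegral_pos_iff_support_of_nonneg_ae]
  · have : Set.Ioi t ⊆ Function.support (wlPdf φ lam) ∩ Set.Ioi t := fun x hx =>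
      ⟨(wlPdf_pos φ lam hφ hlam x (ht.trans hx)).ne', hx⟩
    refine lt_of_lt_of_le ?_ (measure_mono this)
    simp
  · filter_upwards [ae_restrict_mem measurableSet_Ioi] with x hx
    exact (wlPdf_pos φ lam hφ hlam x (ht.trans hx)).le
  · exact wlPdf_int φ lam hφ hlam t ht

lemma wlPdf_mul (φ lam : ℝ) (hφ : 1 ≤ φ) (hlam : 0 < lam) (t x d : ℝ) (ht : 0 < t)
    (hx : t ≤ x) (hd : 0 ≤ d) :
    wlPdf φ lam t * wlPdf φ lam (x + d) ≤ wlPdf φ lam (t + d) * wlPdf φ lam x := by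
  have hG := Real.Gamma_pos_of_pos (show 0 < φ by linarith)
  have hx0 : 0 < x := ht.trans_le hx
  have a : t ^ (φ - 1) * (x + d) ^ (φ - 1) ≤ (t + d) ^ (φ - 1) * x ^ (φ - 1) := by
    rw [← Real.mul_rpow (by positivity) (by positivity),
      ← Real.mul_rpow (by positivity) (by positivity)]
    apply Real.rpow_le_rpow (by positivity) _ (by linarith)
    nlinarith
  have b : (1 + t) * (1 + (x + d)) ≤ (1 + (t + d)) * (1 + x) := by nlinarith
  have ab := mul_le_mul a b (by positivity) (by positivity)
  have e : Real.exp (-(lam * t)) * Real.exp (-(lam * (x + d)))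
      = Real.exp (-(lam * (t + d))) * Real.exp (-(lam * x)) := by
    rw [← Real.exp_add, ← Real.exp_add]; congr 1; ring
  have h := mul_le_mul_of_nonneg_left ab
    (show 0 ≤ (lam ^ (φ + 1) / ((lam + φ) * Real.Gamma φ)) ^ 2 *
      (Real.exp (-(lam * t)) * Real.exp (-(lam * (x + d)))) by positivity)
  unfold wlPdf
  calc _ = _ := by ring
    _ ≤ _ := h
    _ = _ := by rw [e]; ring

theorem wl_hazard_increasing (φ lam : ℝ) (hφ : 1 ≤ φ) (hlam : 0 < lam) :
    ∀ t₁ t₂ : ℝ, 0 < t₁ → t₁ ≤ t₂ → wlHazard φ lam t₁ ≤ wlHazard φ lam t₂ := by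
  intro t₁ t₂ h1 h12
  obtain ⟨d, rfl⟩ : ∃ d, t₂ = t₁ + d := ⟨t₂ - t₁, by ring⟩
  have hd : 0 ≤ d := by linarith
  unfold wlHazard
  rw [div_le_div_iff₀ (wlS_pos φ lam hφ hlam _ h1) (wlS_pos φ lam hφ hlam _ (by linarith))]
  have hs : ∫ x in Set.Ioi (t₁ + d), wlPdf φ lam x = ∫ x in Set.Ioi t₁, wlPdf φ lam (x + d) := by
    rw [← (measurePreserving_add_right volume d).setIntegral_preimage_emb
      (measurableEmbedding_addRight d)]
    simp
  rw [hs, ← integral_const_mul, ← integral_const_mul]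
  apply integral_mono_of_nonneg
  · filter_upwards [ae_restrict_mem measurableSet_Ioi] with x hx
    have hx : t₁ < x := hx
    exact (mul_pos (wlPdf_pos φ lam hφ hlam _ h1)
      (wlPdf_pos φ lam hφ hlam (x + d) (by linarith))).le
  · exact (wlPdf_int φ lam hφ hlam t₁ h1).const_mul _
  · filter_upwards [ae_restrict_mem measurableSet_Ioi] with x hx
    exact wlPdf_mul φ lam hφ hlam t₁ x d h1 (le_of_lt hx) hd
end

section
/- Let 0 < φ < 1, λ > 0 and α = 1, and let f be the corresponding GWL density (i.e., the weighted Lindley density f(t) = λ^{φ+1} t^{φ−1} (1 + t) e^{−λ t} / ((λ + φ) Γ(φ))). Then the hazard function h(t) = f(t) / ∫_t^∞ f(x) dx is bathtub shaped: there exists t₀ > 0 such that h is nonincreasing on (0, t₀] and nondecreasing on [t₀, ∞). -/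
open MeasureTheory Real

noncomputable def uu (φ lam t : ℝ) : ℝ := t ^ (φ - 1) * (1 + t) * Real.exp (-(lam * t))

noncomputable def SS (φ lam t : ℝ) : ℝ := ∫ x in Set.Ioi t, uu φ lam x

noncomputable def et (φ lam t : ℝ) : ℝ := lam + (1 - φ) / t - 1 / (1 + t)

noncomputable def GG (φ lam t : ℝ) : ℝ := SS φ lam t * et φ lam t - uu φ lam t

lemma uu_pos (φ lam t : ℝ) (ht : 0 < t) : 0 < uu φ lam t := by
  unfold uu; positivity

lemma uu_int (φ lam : ℝ) (hφ0 : 0 < φ) (hlam : 0 < lam) :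
    IntegrableOn (uu φ lam) (Set.Ioi 0) := by
  have h1 := integrableOn_rpow_mul_exp_neg_mul_rpow (s := φ - 1) (p := 1) (b := lam)
    (by linarith) (by norm_num) hlam
  have h2 := integrableOn_rpow_mul_exp_neg_mul_rpow (s := φ) (p := 1) (b := lam)
    (by linarith) (by norm_num) hlam
  refine (h1.add h2).congr_fun ?_ measurableSet_Ioi
  intro x hx
  have hx : 0 < x := hx
  have : x ^ φ = x ^ (φ - 1) * x := by
    rw [← Real.rpow_add_one hx.ne']; ring_nf
  simp only [Pi.add_apply, Real.rpow_one, uu, this]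
  ring_nf

lemma uu_deriv (φ lam t : ℝ) (ht : 0 < t) :
    HasDerivAt (uu φ lam) (-(et φ lam t) * uu φ lam t) t := by
  have h1 : HasDerivAt (fun x : ℝ => x ^ (φ - 1)) ((φ - 1) * t ^ (φ - 1 - 1)) t :=
    Real.hasDerivAt_rpow_const (Or.inl ht.ne')
  have h2 : HasDerivAt (fun x : ℝ => 1 + x) 1 t := (hasDerivAt_id t).const_add 1
  have h3 : HasDerivAt (fun x : ℝ => Real.exp (-(lam * x)))
      (Real.exp (-(lam * t)) * (-(lam * 1))) t :=
    (((hasDerivAt_id t).const_mul lam).neg).exp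
  have h := (h1.mul h2).mul h3
  refine h.congr_deriv ?_
  rw [Real.rpow_sub_one ht.ne' (φ - 1)]
  unfold et uu
  have : (1 : ℝ) + t ≠ 0 := by positivity
  simp only [Pi.mul_apply]
  field_simp
  ring

lemma SS_eq (φ lam : ℝ) (hφ0 : 0 < φ) (hlam : 0 < lam) (a t : ℝ) (ha : 0 < a) (ht : 0 < t) :
    SS φ lam t = SS φ lam a - ∫ x in a..t, uu φ lam x := by
  have h := uu_int φ lam hφ0 hlam
  have := intervalIntegral.integral_Ioi_sub_Ioi' (f := uu φ lam) (μ := volume) (a := a) (b := t)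
    (h.mono_set (Set.Ioi_subset_Ioi ha.le)) (h.mono_set (Set.Ioi_subset_Ioi ht.le))
  unfold SS
  linarith

lemma uu_ii (φ lam : ℝ) (hφ0 : 0 < φ) (hlam : 0 < lam) (a t : ℝ) (ha : 0 < a) (ht : 0 < t) :
    IntervalIntegrable (uu φ lam) volume a t := by
  have h := uu_int φ lam hφ0 hlam
  rw [intervalIntegrable_iff]
  refine h.mono_set ?_
  intro x hx
  exact lt_of_le_of_lt (le_min ha.le ht.le) hx.1

lemma SS_deriv (φ lam : ℝ) (hφ0 : 0 < φ) (hlam : 0 < lam) (t : ℝ) (ht : 0 < t) :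
    HasDerivAt (SS φ lam) (-(uu φ lam t)) t := by
  have hm : StronglyMeasurable (uu φ lam) := by
    apply Measurable.stronglyMeasurable
    unfold uu
    fun_prop
  have h := intervalIntegral.integral_hasDerivAt_right
    (uu_ii φ lam hφ0 hlam t t ht ht) hm.stronglyMeasurableAtFilter
    (uu_deriv φ lam t ht).continuousAt
  refine (h.const_sub (SS φ lam t)).congr_of_eventuallyEq ?_
  filter_upwards [lt_mem_nhds ht] with x hx
  exact SS_eq φ lam hφ0 hlam t x ht hx

lemma SS_nonneg (φ lam t : ℝ) (ht : 0 < t) : 0 ≤ SS φ lam t :=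
  setIntegral_nonneg measurableSet_Ioi fun x hx => (uu_pos φ lam x (ht.trans hx)).le

lemma SS_anti (φ lam : ℝ) (hφ0 : 0 < φ) (hlam : 0 < lam) :
    StrictAntiOn (SS φ lam) (Set.Ioi 0) := by
  apply strictAntiOn_of_deriv_neg (convex_Ioi 0)
  · exact fun x hx => (SS_deriv φ lam hφ0 hlam x hx).continuousAt.continuousWithinAt
  · intro x hx
    rw [interior_Ioi] at hx
    rw [(SS_deriv φ lam hφ0 hlam x hx).deriv]
    have := uu_pos φ lam x hx
    linarith

lemma SS_pos (φ lam : ℝ) (hφ0 : 0 < φ) (hlam : 0 < lam) (t : ℝ) (ht : 0 < t) :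
    0 < SS φ lam t := by
  have h1 : 0 < t + 1 := by linarith
  have := SS_anti φ lam hφ0 hlam (show t ∈ Set.Ioi 0 from ht) (show t + 1 ∈ Set.Ioi 0 from h1)
    (by linarith)
  linarith [SS_nonneg φ lam (t + 1) h1]

lemma SS_tendsto (φ lam : ℝ) (hφ0 : 0 < φ) (hlam : 0 < lam) :
    Filter.Tendsto (SS φ lam) Filter.atTop (nhds 0) := by
  have h := (uu_int φ lam hφ0 hlam).mono_set (Set.Ioi_subset_Ioi (zero_le_one))
  have h2 := (intervalIntegral_tendsto_integral_Ioi 1 h Filter.tendsto_id).const_sub (SS φ lam 1)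
  have h3 : SS φ lam 1 - ∫ x in Set.Ioi 1, uu φ lam x = 0 := sub_self _
  rw [h3] at h2
  refine h2.congr' ?_
  filter_upwards [Filter.eventually_gt_atTop 0] with x hx
  exact (SS_eq φ lam hφ0 hlam 1 x one_pos hx).symm

lemma et_deriv (φ lam t : ℝ) (ht : 0 < t) :
    HasDerivAt (et φ lam) (-(1 - φ) / t ^ 2 + 1 / (1 + t) ^ 2) t := by
  have h0 : (1 : ℝ) + t ≠ 0 := by positivity
  have h2 : HasDerivAt (fun x : ℝ => 1 + x) 1 t := (hasDerivAt_id t).const_add 1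
  have h := (((hasDerivAt_const t (1 - φ)).div (hasDerivAt_id t) ht.ne').const_add lam).sub
    ((hasDerivAt_const t (1 : ℝ)).div h2 h0)
  refine h.congr_deriv ?_
  simp only [id]
  field_simp
  ring

lemma GG_deriv (φ lam : ℝ) (hφ0 : 0 < φ) (hlam : 0 < lam) (t : ℝ) (ht : 0 < t) :
    HasDerivAt (GG φ lam) (SS φ lam t * (-(1 - φ) / t ^ 2 + 1 / (1 + t) ^ 2)) t := by
  have h := ((SS_deriv φ lam hφ0 hlam t ht).mul (et_deriv φ lam t ht)).sub (uu_deriv φ lam t ht)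
  refine h.congr_deriv ?_
  ring

lemma gg_deriv (φ lam : ℝ) (hφ0 : 0 < φ) (hlam : 0 < lam) (t : ℝ) (ht : 0 < t) :
    HasDerivAt (fun t => SS φ lam t / uu φ lam t) (GG φ lam t / uu φ lam t) t := by
  have hu := uu_pos φ lam t ht
  have h := (SS_deriv φ lam hφ0 hlam t ht).div (uu_deriv φ lam t ht) hu.ne'
  refine h.congr_deriv ?_
  unfold GG
  field_simp
  ring

lemma haz_eq (φ lam : ℝ) (hφ0 : 0 < φ) (hlam : 0 < lam) (t : ℝ) :
    wlHazard φ lam t = (SS φ lam t / uu φ lam t)⁻¹ := by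
  have hc : 0 < lam ^ (φ + 1) / ((lam + φ) * Real.Gamma φ) := by
    have := Real.Gamma_pos_of_pos hφ0
    positivity
  have e : ∀ x, wlPdf φ lam x = lam ^ (φ + 1) / ((lam + φ) * Real.Gamma φ) * uu φ lam x := by
    intro x; unfold wlPdf uu; ring
  unfold wlHazard SS
  simp only [e]
  rw [integral_const_mul, mul_div_mul_left _ _ hc.ne', inv_div]

theorem wl_hazard_bathtub (φ lam : ℝ) (hφ0 : 0 < φ) (hφ1 : φ < 1) (hlam : 0 < lam) :
    ∃ t₀ : ℝ, 0 < t₀ ∧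
      (∀ t₁ t₂ : ℝ, 0 < t₁ → t₁ ≤ t₂ → t₂ ≤ t₀ →
        wlHazard φ lam t₂ ≤ wlHazard φ lam t₁) ∧
      (∀ t₁ t₂ : ℝ, t₀ ≤ t₁ → t₁ ≤ t₂ →
        wlHazard φ lam t₁ ≤ wlHazard φ lam t₂) := by
  obtain ⟨r, hr0, hr1, hr2⟩ : ∃ r : ℝ, 0 < r ∧ r < 1 ∧ r ^ 2 = 1 - φ := by
    refine ⟨√(1 - φ), Real.sqrt_pos.2 (by linarith), ?_, Real.sq_sqrt (by linarith)⟩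
    rw [Real.sqrt_lt' one_pos]; linarith
  obtain ⟨s, hs0, hs⟩ : ∃ s : ℝ, 0 < s ∧ s = r * (1 + s) := by
    have : 0 < 1 - r := by linarith
    refine ⟨r / (1 - r), by positivity, ?_⟩
    field_simp
    ring
  have hGc : ContinuousOn (GG φ lam) (Set.Ioi 0) := fun x hx =>
    (GG_deriv φ lam hφ0 hlam x hx).continuousAt.continuousWithinAt
  have hanti : AntitoneOn (GG φ lam) (Set.Ioc 0 s) := by
    apply antitoneOn_of_deriv_nonpos (convex_Ioc 0 s) (hGc.mono fun x hx => hx.1)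
    · intro x hx
      rw [interior_Ioc] at hx
      exact (GG_deriv φ lam hφ0 hlam x hx.1).differentiableAt.differentiableWithinAt
    · intro x hx
      rw [interior_Ioc] at hx
      have hx0 := hx.1
      rw [(GG_deriv φ lam hφ0 hlam x hx.1).deriv]
      apply mul_nonpos_of_nonneg_of_nonpos (SS_nonneg _ _ _ hx.1)
      have h1 : x ≤ r * (1 + x) := by nlinarith [hx.2]
      have h2 : x ^ 2 ≤ (1 - φ) * (1 + x) ^ 2 := by
        rw [← hr2, ← mul_pow]; gcongr
      have h3 : 1 / (1 + x) ^ 2 ≤ (1 - φ) / x ^ 2 := by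
        rw [div_le_div_iff₀ (by positivity) (by positivity)]; linarith
      rw [neg_div]; linarith
  have hmono : MonotoneOn (GG φ lam) (Set.Ici s) := by
    apply monotoneOn_of_deriv_nonneg (convex_Ici s) (hGc.mono fun x hx => lt_of_lt_of_le hs0 hx)
    · intro x hx
      rw [interior_Ici] at hx
      exact (GG_deriv φ lam hφ0 hlam x (hs0.trans hx)).differentiableAt.differentiableWithinAt
    · intro x hx
      rw [interior_Ici] at hx
      have hx0 : 0 < x := hs0.trans hx
      have hx1 : s < x := hx
      rw [(GG_deriv φ lam hφ0 hlam x hx0).deriv]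
      apply mul_nonneg (SS_nonneg _ _ _ hx0)
      have h1 : r * (1 + x) ≤ x := by nlinarith
      have h2 : (1 - φ) * (1 + x) ^ 2 ≤ x ^ 2 := by
        rw [← hr2, ← mul_pow]; gcongr
      have h3 : (1 - φ) / x ^ 2 ≤ 1 / (1 + x) ^ 2 := by
        rw [div_le_div_iff₀ (by positivity) (by positivity)]; linarith
      rw [neg_div]; linarith
  have hneg : ∀ t, s ≤ t → GG φ lam t ≤ 0 := by
    intro t ht
    have hl := (SS_tendsto φ lam hφ0 hlam).mul_const (lam + 1)
    rw [zero_mul] at hl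
    refine ge_of_tendsto hl ?_
    filter_upwards [Filter.eventually_ge_atTop 1, Filter.eventually_ge_atTop t] with x hx1 hxt
    refine (hmono ht (ht.trans hxt : s ≤ x) hxt).trans ?_
    have hx0 : 0 < x := by linarith
    have h1 : et φ lam x ≤ lam + 1 := by
      unfold et
      have : (1 - φ) / x ≤ 1 := by rw [div_le_one hx0]; linarith
      have : 0 ≤ 1 / (1 + x) := by positivity
      linarith
    have := mul_le_mul_of_nonneg_left h1 (SS_nonneg φ lam x hx0)
    have := uu_pos φ lam x hx0
    unfold GG; linarith
  obtain ⟨p, hp0, hps, hp⟩ : ∃ p, 0 < p ∧ p < s ∧ 0 < GG φ lam p := by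
    have hc : ContinuousAt (fun t : ℝ => SS φ lam s * (1 - φ - t) - t ^ φ * (1 + t)) 0 := by
      have : ContinuousAt (fun t : ℝ => t ^ φ) 0 :=
        Real.continuousAt_rpow_const _ _ (Or.inr hφ0.le)
      fun_prop
    have hSs := SS_pos φ lam hφ0 hlam s hs0
    have h0 : (0 : ℝ) < (fun t : ℝ => SS φ lam s * (1 - φ - t) - t ^ φ * (1 + t)) 0 := by
      simp only [Real.zero_rpow hφ0.ne']
      have : 0 < SS φ lam s * (1 - φ) := mul_pos hSs (by linarith)
      linarith
    have hev := (hc.eventually (lt_mem_nhds h0)).filter_mono (nhdsWithin_le_nhds (s := Set.Ioi 0))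
    have hev2 : ∀ᶠ x in nhdsWithin (0 : ℝ) (Set.Ioi 0), x ∈ Set.Ioo 0 (min s (1 - φ)) :=
      Ioo_mem_nhdsGT (lt_min hs0 (by linarith))
    obtain ⟨p, h1, h2, h3⟩ := (hev.and hev2).exists
    have hps := h3.trans_le (min_le_left _ _)
    have hpf := h3.trans_le (min_le_right _ _)
    refine ⟨p, h2, hps, ?_⟩
    have hS := (SS_anti φ lam hφ0 hlam (show p ∈ Set.Ioi 0 from h2)
      (show s ∈ Set.Ioi 0 from hs0) hps).le
    have hpp : p ^ φ = p ^ (φ - 1) * p := by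
      rw [← Real.rpow_add_one h2.ne']; ring_nf
    have hu : p * uu φ lam p ≤ p ^ φ * (1 + p) := by
      rw [hpp]; unfold uu
      have : Real.exp (-(lam * p)) ≤ 1 := Real.exp_le_one_iff.2 (by
        have := mul_pos hlam h2; linarith)
      have h4 : 0 ≤ p ^ (φ - 1) * p * (1 + p) := by positivity
      nlinarith
    have he : 1 - φ - p ≤ p * et φ lam p := by
      have : p * et φ lam p = lam * p + (1 - φ) - p * (1 / (1 + p)) := by
        unfold et; field_simp
      rw [this]
      have h5 : 1 / (1 + p) ≤ 1 := by rw [div_le_one (by linarith)]; linarith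
      have := mul_le_mul_of_nonneg_left h5 h2.le
      have := mul_pos hlam h2
      linarith
    have hk : SS φ lam s * (1 - φ - p) ≤ SS φ lam p * (p * et φ lam p) :=
      mul_le_mul hS he (by linarith) (by linarith)
    have : 0 < p * GG φ lam p := by
      unfold GG
      linarith
    exact pos_of_mul_pos_right this h2.le
  obtain ⟨t₀, ht₀, hG⟩ : ∃ t₀ ∈ Set.Icc p s, GG φ lam t₀ = 0 :=
    intermediate_value_Icc' hps.le (hGc.mono fun x hx => lt_of_lt_of_le hp0 hx.1)
      ⟨hneg s le_rfl, hp.le⟩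
  have h00 : 0 < t₀ := hp0.trans_le ht₀.1
  have hgc : ContinuousOn (fun t => SS φ lam t / uu φ lam t) (Set.Ioi 0) := fun x hx =>
    (gg_deriv φ lam hφ0 hlam x hx).continuousAt.continuousWithinAt
  have hgpos : ∀ t, 0 < t → 0 < SS φ lam t / uu φ lam t := fun t ht =>
    div_pos (SS_pos φ lam hφ0 hlam t ht) (uu_pos φ lam t ht)
  have hg1 : MonotoneOn (fun t => SS φ lam t / uu φ lam t) (Set.Ioc 0 t₀) := by
    apply monotoneOn_of_deriv_nonneg (convex_Ioc 0 t₀) (hgc.mono fun x hx => hx.1)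
    · intro x hx
      rw [interior_Ioc] at hx
      exact (gg_deriv φ lam hφ0 hlam x hx.1).differentiableAt.differentiableWithinAt
    · intro x hx
      rw [interior_Ioc] at hx
      rw [(gg_deriv φ lam hφ0 hlam x hx.1).deriv]
      refine div_nonneg ?_ (uu_pos φ lam x hx.1).le
      rw [← hG]
      exact hanti ⟨hx.1, hx.2.le.trans ht₀.2⟩ ⟨h00, ht₀.2⟩ hx.2.le
  have hg2 : AntitoneOn (fun t => SS φ lam t / uu φ lam t) (Set.Ici t₀) := by
    apply antitoneOn_of_deriv_nonpos (convex_Ici t₀) (hgc.mono fun x hx => lt_of_lt_of_le h00 hx)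
    · intro x hx
      rw [interior_Ici] at hx
      exact (gg_deriv φ lam hφ0 hlam x (h00.trans hx)).differentiableAt.differentiableWithinAt
    · intro x hx
      rw [interior_Ici] at hx
      have hx1 : t₀ < x := hx
      have hx0 : 0 < x := h00.trans hx
      rw [(gg_deriv φ lam hφ0 hlam x hx0).deriv]
      refine div_nonpos_of_nonpos_of_nonneg ?_ (uu_pos φ lam x hx0).le
      rcases le_total x s with h | h
      · rw [← hG]
        exact hanti ⟨h00, ht₀.2⟩ ⟨hx0, h⟩ hx1.le
      · exact hneg x h
  refine ⟨t₀, h00, ?_, ?_⟩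
  · intro a b ha hab hb
    rw [haz_eq φ lam hφ0 hlam, haz_eq φ lam hφ0 hlam]
    exact inv_anti₀ (hgpos a ha) (hg1 ⟨ha, hab.trans hb⟩ ⟨ha.trans_le hab, hb⟩ hab)
  · intro a b ha hab
    rw [haz_eq φ lam hφ0 hlam, haz_eq φ lam hφ0 hlam]
    exact inv_anti₀ (hgpos b (h00.trans_le (ha.trans hab))) (hg2 ha (ha.trans hab : t₀ ≤ b) hab)
end

section
/- Let φ = 1, λ > 0 and α ≥ 1, and let f be the corresponding GWL density f(t) = α λ^α t^{α−1} (λ + (λ t)^α) e^{−(λ t)^α} / (λ + 1) (a power Lindley density up to rescaling). Then the hazard function h(t) = f(t) / ∫_t^∞ f(x) dx is increasing on (0, ∞): for all 0 < t₁ ≤ t₂, h(t₁) ≤ h(t₂). -/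
open MeasureTheory Real

/-- The power Lindley probability density function (GWL density with `φ = 1`). -/
noncomputable def plPdf (lam α t : ℝ) : ℝ :=
  α * lam ^ α * t ^ (α - 1) * (lam + (lam * t) ^ α) * Real.exp (-(lam * t) ^ α) /
    (lam + 1)

/-- The hazard function of the power Lindley distribution. -/
noncomputable def plHazard (lam α t : ℝ) : ℝ :=
  plPdf lam α t / ∫ x in Set.Ioi t, plPdf lam α x

theorem pl_surv_deriv (lam α t : ℝ) (hlam : 0 < lam) (ht : 0 < t) :
    HasDerivAt (fun x : ℝ => -((lam + 1 + (lam * x) ^ α) * Real.exp (-(lam * x) ^ α) / (lam + 1)))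
      (plPdf lam α t) t := by
  have hu : HasDerivAt (fun x : ℝ => (lam * x) ^ α) (α * lam ^ α * t ^ (α - 1)) t := by
    have h1 : HasDerivAt (fun x : ℝ => lam * x) lam t := by
      simpa using (hasDerivAt_id t).const_mul lam
    have h2 := h1.rpow_const (p := α) (Or.inl (by positivity))
    convert h2 using 1
    rw [Real.mul_rpow hlam.le ht.le, Real.rpow_sub_one hlam.ne']
    field_simp
  have h := (((hu.const_add (lam + 1)).mul hu.neg.exp).div_const (lam + 1)).neg
  refine HasDerivAt.congr_deriv h ?_
  unfold plPdf
  simp only [Pi.neg_apply]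
  field_simp
  ring

theorem pl_surv (lam α t : ℝ) (hlam : 0 < lam) (hα : 1 ≤ α) (ht : 0 < t) :
    ∫ x in Set.Ioi t, plPdf lam α x =
      (lam + 1 + (lam * t) ^ α) * Real.exp (-(lam * t) ^ α) / (lam + 1) := by
  have hlim : Filter.Tendsto
      (fun x : ℝ => -((lam + 1 + (lam * x) ^ α) * Real.exp (-(lam * x) ^ α) / (lam + 1)))
      Filter.atTop (nhds 0) := by
    have hu : Filter.Tendsto (fun x : ℝ => (lam * x) ^ α) Filter.atTop Filter.atTop :=
      (tendsto_rpow_atTop (by linarith)).comp (Filter.tendsto_id.const_mul_atTop hlam)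
    have h0 : Filter.Tendsto (fun u : ℝ => -((lam + 1 + u) * Real.exp (-u) / (lam + 1)))
        Filter.atTop (nhds 0) := by
      have a := Real.tendsto_pow_mul_exp_neg_atTop_nhds_zero 0
      have b := Real.tendsto_pow_mul_exp_neg_atTop_nhds_zero 1
      have c := (((a.const_mul (lam + 1)).add b).div_const (lam + 1)).neg
      simp only [mul_zero, add_zero, zero_div, neg_zero] at c
      refine c.congr fun u => ?_
      ring
    exact h0.comp hu
  rw [integral_Ioi_of_hasDerivAt_of_nonneg'
    (fun x hx => pl_surv_deriv lam α x hlam (lt_of_lt_of_le ht hx)) ?_ hlim]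
  · ring
  · intro x hx
    have hx : 0 < x := ht.trans hx
    unfold plPdf
    positivity

theorem pl_hazard_eq (lam α t : ℝ) (hlam : 0 < lam) (hα : 1 ≤ α) (ht : 0 < t) :
    plHazard lam α t =
      α * lam ^ α * t ^ (α - 1) * ((lam + (lam * t) ^ α) / (lam + 1 + (lam * t) ^ α)) := by
  have h1 : 0 < (lam * t) ^ α := by positivity
  have h2 : lam + 1 + (lam * t) ^ α ≠ 0 := by positivity
  have h3 := (Real.exp_pos (-(lam * t) ^ α)).ne'
  rw [plHazard, pl_surv lam α t hlam hα ht, plPdf]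
  field_simp

theorem pl_hazard_increasing (lam α : ℝ) (hlam : 0 < lam) (hα : 1 ≤ α) :
    ∀ t₁ t₂ : ℝ, 0 < t₁ → t₁ ≤ t₂ → plHazard lam α t₁ ≤ plHazard lam α t₂ := by
  intro t₁ t₂ h₁ h
  have h₂ : 0 < t₂ := h₁.trans_le h
  rw [pl_hazard_eq lam α t₁ hlam hα h₁, pl_hazard_eq lam α t₂ hlam hα h₂]
  have hp : t₁ ^ (α - 1) ≤ t₂ ^ (α - 1) := Real.rpow_le_rpow h₁.le h (by linarith)
  have hu : (lam * t₁) ^ α ≤ (lam * t₂) ^ α :=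
    Real.rpow_le_rpow (by positivity) (by gcongr) (by linarith)
  have hu1 : 0 < (lam * t₁) ^ α := by positivity
  have hu2 : 0 < (lam * t₂) ^ α := by positivity
  have hq : (lam + (lam * t₁) ^ α) / (lam + 1 + (lam * t₁) ^ α) ≤
      (lam + (lam * t₂) ^ α) / (lam + 1 + (lam * t₂) ^ α) := by
    rw [div_le_div_iff₀ (by positivity) (by positivity)]
    nlinarith
  have hα0 : 0 < α := by linarith
  have hc : 0 ≤ α * lam ^ α := by positivity
  apply mul_le_mul (mul_le_mul_of_nonneg_left hp hc) hq <;> positivity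
end

section
/- Let φ > 0, λ > 0, α > 0 and let f be the GWL density with survival function S(t) = ∫_t^∞ f(x) dx. For every t > 0, the mean residual life function r(t) = (1/S(t)) ∫_t^∞ y f(y) dy − t satisfies r(t) = [ (φ + 1/α + λ) Γ(φ + 1/α, (λ t)^α) − λ t (λ + φ) Γ(φ, (λ t)^α) ] / ( λ [ (λ + φ) Γ(φ, (λ t)^α) + (λ t)^{αφ} e^{−(λ t)^α} ] ), where Γ(s, x) = ∫_x^∞ w^{s−1} e^{−w} dw is the upper incomplete gamma function. -/
open MeasureTheory Real

/-- The mean residual life function of the GWL distribution. -/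
noncomputable def gwlMrl (φ lam α t : ℝ) : ℝ :=
  (1 / ∫ x in Set.Ioi t, gwlPdf φ lam α x) *
    (∫ y in Set.Ioi t, y * gwlPdf φ lam α y) - t

theorem gwl_int {s u : ℝ} (hs : 0 < s) (hu : 0 < u) :
    IntegrableOn (fun w : ℝ => w ^ (s - 1) * Real.exp (-w)) (Set.Ioi u) := by
  have h := (Real.GammaIntegral_convergent hs).mono_set (Set.Ioi_subset_Ioi hu.le)
  simpa only [mul_comm] using h

theorem gwl_rec {s u : ℝ} (hs : 0 < s) (hu : 0 < u) :
    upperIncGamma (s + 1) u = s * upperIncGamma s u + u ^ s * Real.exp (-u) := by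
  have i1 := gwl_int hs hu
  have i2 := gwl_int (s := s + 1) (by linarith) hu
  have hd : ∀ x ∈ Set.Ici u, HasDerivAt (fun w : ℝ => w ^ s * Real.exp (-w))
      (s * (x ^ (s - 1) * Real.exp (-x)) - x ^ (s + 1 - 1) * Real.exp (-x)) x := by
    intro x hx
    have hx0 : 0 < x := lt_of_lt_of_le hu hx
    have h1 := (Real.hasDerivAt_rpow_const (x := x) (p := s) (Or.inl hx0.ne')).mul
      ((hasDerivAt_neg x).exp)
    convert! h1 using 1
    rw [add_sub_cancel_right]
    ring
  have hl : Filter.Tendsto (fun w : ℝ => w ^ s * Real.exp (-w)) Filter.atTop (nhds 0) := by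
    simpa using tendsto_rpow_mul_exp_neg_mul_atTop_nhds_zero s 1 one_pos
  have h := integral_Ioi_of_hasDerivAt_of_tendsto' hd ((i1.const_mul s).sub i2) hl
  rw [integral_sub (i1.const_mul s) i2, integral_const_mul] at h
  unfold upperIncGamma
  linarith

theorem gwl_A {s u lam : ℝ} (hs : 0 < s) (hu : 0 < u) :
    ∫ w in Set.Ioi u, w ^ (s - 1) * (lam + w) * Real.exp (-w) =
      (lam + s) * upperIncGamma s u + u ^ s * Real.exp (-u) := by
  have i1 := gwl_int hs hu
  have i2 := gwl_int (s := s + 1) (by linarith) hu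
  have h : ∫ w in Set.Ioi u, w ^ (s - 1) * (lam + w) * Real.exp (-w) =
      ∫ w in Set.Ioi u, (lam * (w ^ (s - 1) * Real.exp (-w)) +
        w ^ (s + 1 - 1) * Real.exp (-w)) := by
    refine setIntegral_congr_fun measurableSet_Ioi (fun w hw => ?_)
    have hw0 : 0 < w := hu.trans hw
    have : w ^ (s + 1 - 1) = w ^ (s - 1) * w := by
      rw [← Real.rpow_add_one hw0.ne']; congr 1; ring
    simp only [this]
    ring
  rw [h, integral_add (i1.const_mul lam) i2, integral_const_mul]
  have := gwl_rec hs hu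
  unfold upperIncGamma at *
  rw [this]; ring

theorem gwl_subst {lam α t : ℝ} (hlam : 0 < lam) (hα : 0 < α) (ht : 0 < t) (g : ℝ → ℝ) :
    ∫ x in Set.Ioi t, lam * (α * (lam * x) ^ (α - 1) * g ((lam * x) ^ α)) =
      ∫ w in Set.Ioi ((lam * t) ^ α), g w := by
  have hlt : 0 < lam * t := mul_pos hlam ht
  rw [← integral_comp_rpow_Ioi_of_pos' hα (Real.rpow_nonneg hlt.le α),
    Real.rpow_rpow_inv hlt.le hα.ne', ← integral_comp_mul_left_Ioi' _ _ hlam,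
    integral_const_mul]
  simp only [smul_eq_mul]

theorem gwl_mean_residual_life (φ lam α : ℝ) (hφ : 0 < φ) (hlam : 0 < lam)
    (hα : 0 < α) :
    ∀ t : ℝ, 0 < t →
      gwlMrl φ lam α t =
        ((φ + 1 / α + lam) * upperIncGamma (φ + 1 / α) ((lam * t) ^ α) -
            lam * t * (lam + φ) * upperIncGamma φ ((lam * t) ^ α)) /
          (lam * ((lam + φ) * upperIncGamma φ ((lam * t) ^ α) +
            (lam * t) ^ (α * φ) * Real.exp (-(lam * t) ^ α))) := by
  intro t ht
  have hlt : 0 < lam * t := mul_pos hlam ht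
  have hu : 0 < (lam * t) ^ α := Real.rpow_pos_of_pos hlt α
  have hG := Real.Gamma_pos_of_pos hφ
  have hs : 0 < φ + 1 / α := by positivity
  set C := (lam + φ) * Real.Gamma φ with hC
  have hC0 : 0 < C := by positivity
  have hS : ∫ x in Set.Ioi t, gwlPdf φ lam α x =
      ((lam + φ) * upperIncGamma φ ((lam * t) ^ α) +
        (lam * t) ^ (α * φ) * Real.exp (-(lam * t) ^ α)) / C := by
    rw [Real.rpow_mul hlt.le, ← gwl_A hφ hu, ← integral_div, ← gwl_subst hlam hα ht]
    refine setIntegral_congr_fun measurableSet_Ioi (fun x hx => ?_)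
    have hx0 : 0 < x := ht.trans hx
    have hlx : 0 < lam * x := mul_pos hlam hx0
    have e : lam ^ (α * φ) * x ^ (α * φ - 1) =
        lam * ((lam * x) ^ (α - 1) * ((lam * x) ^ α) ^ (φ - 1)) := by
      rw [← Real.rpow_mul hlx.le, ← Real.rpow_add hlx,
        show α - 1 + α * (φ - 1) = α * φ - 1 by ring, Real.mul_rpow hlam.le hx0.le,
        Real.rpow_sub_one hlam.ne']
      field_simp
    simp only [gwlPdf, ← hC]
    rw [mul_assoc α, e]
    ring
  have hM : ∫ y in Set.Ioi t, y * gwlPdf φ lam α y =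
      ((lam + (φ + 1 / α)) * upperIncGamma (φ + 1 / α) ((lam * t) ^ α) +
        lam * t * (lam * t) ^ (α * φ) * Real.exp (-(lam * t) ^ α)) / (lam * C) := by
    have e0 : lam * t * (lam * t) ^ (α * φ) = ((lam * t) ^ α) ^ (φ + 1 / α) := by
      rw [← Real.rpow_mul hlt.le, mul_comm, ← Real.rpow_add_one hlt.ne']
      congr 1
      field_simp
    rw [e0, ← gwl_A hs hu, ← integral_div, ← gwl_subst hlam hα ht]
    refine setIntegral_congr_fun measurableSet_Ioi (fun x hx => ?_)
    have hx0 : 0 < x := ht.trans hx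
    have hlx : 0 < lam * x := mul_pos hlam hx0
    have e : x * (lam ^ (α * φ) * x ^ (α * φ - 1)) =
        ((lam * x) ^ (α - 1) * ((lam * x) ^ α) ^ (φ + 1 / α - 1)) := by
      rw [← Real.rpow_mul hlx.le, ← Real.rpow_add hlx,
        show α - 1 + α * (φ + 1 / α - 1) = α * φ by field_simp; ring,
        Real.mul_rpow hlam.le hx0.le, Real.rpow_sub_one hx0.ne']
      field_simp
    simp only [gwlPdf, ← hC]
    calc _ = α * (x * (lam ^ (α * φ) * x ^ (α * φ - 1))) * (lam + (lam * x) ^ α) *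
          Real.exp (-(lam * x) ^ α) / C := by ring
      _ = _ := by
        rw [e]
        field_simp
  have hI : 0 ≤ upperIncGamma φ ((lam * t) ^ α) := by
    unfold upperIncGamma
    refine setIntegral_nonneg measurableSet_Ioi (fun w hw => ?_)
    have hw0 : 0 < w := hu.trans hw
    positivity
  have hD : 0 < (lam + φ) * upperIncGamma φ ((lam * t) ^ α) +
        (lam * t) ^ (α * φ) * Real.exp (-(lam * t) ^ α) := by positivity
  unfold gwlMrl
  rw [hS, hM]
  generalize Real.exp (-(lam * t) ^ α) = E at *
  generalize (lam * t) ^ (α * φ) = P at *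
  generalize upperIncGamma φ ((lam * t) ^ α) = I at *
  generalize upperIncGamma (φ + 1 / α) ((lam * t) ^ α) = J at *
  generalize hDD : (lam + φ) * I + P * E = D at *
  have hPE : P * E = D - (lam + φ) * I := by linarith
  rw [mul_assoc (lam * t), hPE]
  generalize 1 / α = a at *
  field_simp
  ring
end

section
/- Let φ > 0, λ > 0, α > 0, let f be the GWL density, and let ρ > 0 satisfy ρ(αφ − 1) + 1 > 0. Then ∫₀^∞ f(t)^ρ dt = ( α^{ρ−1} λ^{ρ−1} / ( (λ + φ)^ρ Γ(φ)^ρ ) ) · ∫₀^∞ y^{(αρφ − ρ + 1 − α)/α} (λ + y)^ρ e^{−ρ y} dy; consequently the Rényi entropy (1/(1 − ρ)) log ∫₀^∞ f(t)^ρ dt (for ρ ≠ 1) equals [ (ρ − 1)(log α + log λ) − ρ( log(λ + φ) + log Γ(φ) ) + log δ(ρ, φ, λ, α) ] / (1 − ρ), where δ(ρ, φ, λ, α) = ∫₀^∞ y^{(αρφ − ρ + 1 − α)/α} (λ + y)^ρ e^{−ρ y} dy. -/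
open MeasureTheory Real

/-- The auxiliary integral `δ(ρ, φ, lam, α)` appearing in the Rényi entropy. -/
noncomputable def deltaAux (ρ φ lam α : ℝ) : ℝ :=
  ∫ y in Set.Ioi (0 : ℝ),
    y ^ ((α * ρ * φ - ρ + 1 - α) / α) * (lam + y) ^ ρ * Real.exp (-(ρ * y))


lemma gwl_pow_eq (φ lam α ρ t : ℝ) (hφ : 0 < φ) (hlam : 0 < lam)
    (hα : 0 < α) (ht : 0 < t) :
    gwlPdf φ lam α t ^ ρ =
      α ^ (ρ - 1) * lam ^ ρ / ((lam + φ) ^ ρ * Real.Gamma φ ^ ρ) *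
        ((α * (lam * t) ^ (α - 1)) * (((lam * t) ^ α) ^ ((α * ρ * φ - ρ + 1 - α) / α) *
          (lam + (lam * t) ^ α) ^ ρ * Real.exp (-(ρ * (lam * t) ^ α)))) := by
  have hG : 0 < Real.Gamma φ := Real.Gamma_pos_of_pos hφ
  have hs : 0 < lam * t := by positivity
  have h1 : gwlPdf φ lam α t = α * lam * (lam * t) ^ (α * φ - 1) * (lam + (lam * t) ^ α) *
      Real.exp (-(lam * t) ^ α) / ((lam + φ) * Real.Gamma φ) := by
    unfold gwlPdf
    rw [Real.mul_rpow (z := α * φ - 1) hlam.le ht.le, Real.rpow_sub_one hlam.ne']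
    field_simp
  rw [h1]
  clear h1
  generalize lam * t = s at hs ⊢
  have hu : 0 < (s) ^ α := by positivity
  have hv : 0 < (s) ^ (α * φ - 1) := by positivity
  rw [Real.div_rpow (by positivity) (by positivity), Real.mul_rpow (by positivity) (by positivity),
    Real.mul_rpow (by positivity) (by positivity), Real.mul_rpow (by positivity) (by positivity),
    Real.mul_rpow (by positivity) (by positivity), Real.mul_rpow (by positivity) (by positivity),
    ← Real.exp_mul, ← Real.rpow_mul hs.le, ← Real.rpow_mul hs.le]
  have h2 : (s) ^ ((α * φ - 1) * ρ) = (s) ^ (α - 1) *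
      (s) ^ (α * ((α * ρ * φ - ρ + 1 - α) / α)) := by
    rw [← Real.rpow_add hs]
    congr 1
    field_simp
    ring
  rw [h2, Real.rpow_sub_one hα.ne']
  have h3 : -(s) ^ α * ρ = -(ρ * (s) ^ α) := by ring
  rw [h3]
  field_simp

lemma deltaAux_pos (φ lam α ρ : ℝ) (hlam : 0 < lam)
    (hα : 0 < α) (hρ : 0 < ρ) (hρφ : 0 < ρ * (α * φ - 1) + 1) :
    0 < deltaAux ρ φ lam α := by
  unfold deltaAux
  set e := (α * ρ * φ - ρ + 1 - α) / α with he
  have he1 : -1 < e := by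
    rw [he, lt_div_iff₀ hα]
    nlinarith
  have i1 := integrableOn_rpow_mul_exp_neg_mul_rpow he1 one_pos hρ
  have i2 := integrableOn_rpow_mul_exp_neg_mul_rpow (show -1 < e + ρ by linarith) one_pos hρ
  have hint : IntegrableOn (fun y : ℝ => y ^ e * (lam + y) ^ ρ * Real.exp (-(ρ * y)))
      (Set.Ioi 0) := by
    refine ((i1.const_mul ((2 * lam) ^ ρ)).add (i2.const_mul (2 ^ ρ))).mono' ?_ ?_
    · exact Measurable.aestronglyMeasurable (by fun_prop)
    · refine (ae_restrict_iff' measurableSet_Ioi).2 (Filter.Eventually.of_forall ?_)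
      intro y hy
      have hy : 0 < y := hy
      have hE : Real.exp (-ρ * y ^ (1:ℝ)) = Real.exp (-(ρ * y)) := by
        rw [Real.rpow_one, neg_mul]
      have hb : (lam + y) ^ ρ ≤ (2 * lam) ^ ρ + 2 ^ ρ * y ^ ρ := by
        rw [← Real.mul_rpow two_pos.le hy.le]
        have a1 : 0 ≤ (2 * lam) ^ ρ := by positivity
        have a2 : 0 ≤ (2 * y) ^ ρ := by positivity
        rcases le_total lam y with h | h
        · have := Real.rpow_le_rpow (by positivity) (show lam + y ≤ 2 * y by linarith) hρ.le
          linarith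
        · have := Real.rpow_le_rpow (by positivity) (show lam + y ≤ 2 * lam by linarith) hρ.le
          linarith
      simp only [Pi.add_apply, hE]
      rw [Real.norm_of_nonneg (by positivity), Real.rpow_add hy]
      have hp : 0 ≤ y ^ e * Real.exp (-(ρ * y)) := by positivity
      nlinarith [mul_le_mul_of_nonneg_left hb hp]
  rw [setIntegral_pos_iff_support_of_nonneg_ae _ hint]
  · have : Set.Ioi (0:ℝ) ⊆ (Function.support
        fun y : ℝ => y ^ e * (lam + y) ^ ρ * Real.exp (-(ρ * y))) ∩ Set.Ioi 0 := by
      intro y hy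
      have hy' : 0 < y := hy
      refine ⟨?_, hy⟩
      rw [Function.mem_support]
      positivity
    refine lt_of_lt_of_le ?_ (measure_mono this)
    simp
  · refine (ae_restrict_iff' measurableSet_Ioi).2 (Filter.Eventually.of_forall ?_)
    intro y hy
    have hy : 0 < y := hy
    simp only [Pi.zero_apply]
    positivity

theorem gwl_renyi_entropy (φ lam α ρ : ℝ) (hφ : 0 < φ) (hlam : 0 < lam)
    (hα : 0 < α) (hρ : 0 < ρ) (hρφ : 0 < ρ * (α * φ - 1) + 1) :
    (∫ t in Set.Ioi (0 : ℝ), gwlPdf φ lam α t ^ ρ =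
      α ^ (ρ - 1) * lam ^ (ρ - 1) / ((lam + φ) ^ ρ * Real.Gamma φ ^ ρ) *
        deltaAux ρ φ lam α) ∧
    (ρ ≠ 1 →
      (1 / (1 - ρ)) * Real.log (∫ t in Set.Ioi (0 : ℝ), gwlPdf φ lam α t ^ ρ) =
        ((ρ - 1) * (Real.log α + Real.log lam) -
            ρ * (Real.log (lam + φ) + Real.log (Real.Gamma φ)) +
            Real.log (deltaAux ρ φ lam α)) / (1 - ρ)) := by
  have hG : 0 < Real.Gamma φ := Real.Gamma_pos_of_pos hφ
  have hδ := deltaAux_pos φ lam α ρ hlam hα hρ hρφ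
  have main : ∫ t in Set.Ioi (0 : ℝ), gwlPdf φ lam α t ^ ρ =
      α ^ (ρ - 1) * lam ^ (ρ - 1) / ((lam + φ) ^ ρ * Real.Gamma φ ^ ρ) *
        deltaAux ρ φ lam α := by
    rw [setIntegral_congr_fun measurableSet_Ioi
      (fun t ht => gwl_pow_eq φ lam α ρ t hφ hlam hα ht), integral_const_mul]
    have c1 := integral_comp_mul_left_Ioi (fun s : ℝ => (α * s ^ (α - 1)) *
      ((s ^ α) ^ ((α * ρ * φ - ρ + 1 - α) / α) *
          (lam + s ^ α) ^ ρ * Real.exp (-(ρ * s ^ α)))) 0 hlam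
    have c2 := integral_comp_rpow_Ioi_of_pos (g := fun y : ℝ =>
      y ^ ((α * ρ * φ - ρ + 1 - α) / α) * (lam + y) ^ ρ * Real.exp (-(ρ * y))) hα
    simp only [smul_eq_mul, mul_zero] at c1 c2
    rw [c1, c2, ← deltaAux, Real.rpow_sub_one hlam.ne']
    field_simp
  refine ⟨main, fun _ => ?_⟩
  rw [main, Real.log_mul (by positivity) hδ.ne', Real.log_div (by positivity) (by positivity),
    Real.log_mul (by positivity) (by positivity), Real.log_mul (by positivity) (by positivity),
    Real.log_rpow hα, Real.log_rpow hlam, Real.log_rpow (by positivity), Real.log_rpow hG]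
  ring
end

section
/- Let φ > 0, λ > 0, α > 0, let f be the GWL density, and let μ = ((1/α + φ + λ) Γ(1/α + φ)) / (λ (λ + φ) Γ(φ)) be its mean. For every t > 0, the (scaled) incomplete first moment defining the Lorenz curve satisfies (1/μ) ∫₀^t x f(x) dx = [ γ(φ + 1 + 1/α, (λ t)^α) + λ γ(φ + 1/α, (λ t)^α) ] / ( (1/α + φ + λ) Γ(1/α + φ) ), where γ(s, x) = ∫₀^x w^{s−1} e^{−w} dw is the lower incomplete gamma function. -/
open MeasureTheory Real

theorem gwl_lorenz_curve (φ lam α : ℝ) (hφ : 0 < φ) (hlam : 0 < lam) (hα : 0 < α)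
    (μ : ℝ)
    (hμ : μ = ((1 / α + φ + lam) * Real.Gamma (1 / α + φ)) /
      (lam * (lam + φ) * Real.Gamma φ)) :
    ∀ t : ℝ, 0 < t →
      (1 / μ) * ∫ x in (0 : ℝ)..t, x * gwlPdf φ lam α x =
        (lowerIncGamma (φ + 1 + 1 / α) ((lam * t) ^ α) +
            lam * lowerIncGamma (φ + 1 / α) ((lam * t) ^ α)) /
          ((1 / α + φ + lam) * Real.Gamma (1 / α + φ)) := by
  intro t ht
  have hC : 0 < (lam + φ) * Real.Gamma φ := mul_pos (by positivity) (Real.Gamma_pos_of_pos hφ)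
  have hG : 0 < Real.Gamma φ := Real.Gamma_pos_of_pos hφ
  have hα' : 0 < 1 / α := by positivity
  have hG2 : 0 < Real.Gamma (1 / α + φ) := Real.Gamma_pos_of_pos (by positivity)
  have hsplit : ∀ s : ℝ, 0 < s → ∀ T : ℝ,
      IntervalIntegrable (fun w : ℝ => w ^ (s - 1) * Real.exp (-w)) volume 0 T := by
    intro s hs T
    exact (intervalIntegral.intervalIntegrable_rpow' (by linarith)).mul_continuousOn
      (by fun_prop)
  have hT : 0 < (lam * t) ^ α := Real.rpow_pos_of_pos (by positivity) _
  let g : ℝ → ℝ := fun w => w ^ (φ + 1 + 1 / α - 1) * Real.exp (-w) +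
    lam * (w ^ (φ + 1 / α - 1) * Real.exp (-w))
  have hg : ∫ u in (0 : ℝ)..(lam * t) ^ α, g u =
      lowerIncGamma (φ + 1 + 1 / α) ((lam * t) ^ α) +
            lam * lowerIncGamma (φ + 1 / α) ((lam * t) ^ α) := by
    simp only [g, lowerIncGamma]
    rw [intervalIntegral.integral_add (hsplit _ (by positivity) _)
      ((hsplit _ (by positivity) _).const_mul _), intervalIntegral.integral_const_mul]
  have hsub := intervalIntegral.integral_comp_mul_deriv_of_deriv_nonneg (a := 0) (b := t)
    (f := fun x => (lam * x) ^ α) (f' := fun x => lam * α * (lam * x) ^ (α - 1)) (g := g)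
    (by
      apply Continuous.continuousOn
      exact (continuous_const.mul continuous_id).rpow_const (fun _ => Or.inr hα.le))
    (by
      intro x hx
      rw [min_eq_left ht.le, max_eq_right ht.le] at hx
      have h1 : HasDerivAt (fun x : ℝ => lam * x) lam x := by
        simpa using (hasDerivAt_id x).const_mul lam
      exact h1.rpow_const (Or.inl (mul_pos hlam hx.1).ne'))
    (by
      intro x hx
      rw [min_eq_left ht.le, max_eq_right ht.le] at hx
      have := hx.1
      positivity)
  simp only [mul_zero, Real.zero_rpow hα.ne'] at hsub
  rw [hg] at hsub
  have hpt : ∫ x in (0 : ℝ)..t, x * gwlPdf φ lam α x =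
      (1 / (lam * ((lam + φ) * Real.Gamma φ))) *
      ∫ x in (0 : ℝ)..t, (g ∘ fun x => (lam * x) ^ α) x * (lam * α * (lam * x) ^ (α - 1)) := by
    rw [← intervalIntegral.integral_const_mul]
    apply intervalIntegral.integral_congr_ae
    refine Filter.Eventually.of_forall fun x hx => ?_
    rw [Set.uIoc_of_le ht.le] at hx
    have hx0 : 0 < x := hx.1
    have hy : 0 < lam * x := by positivity
    have hw : 0 < (lam * x) ^ α := Real.rpow_pos_of_pos hy _
    have e1 : x ^ (α * φ) = x * x ^ (α * φ - 1) := by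
      rw [Real.rpow_sub_one hx0.ne']; field_simp
    have e2 : ((lam * x) ^ α) ^ (φ + 1 / α - 1) * (lam * x) ^ (α - 1) =
        lam ^ (α * φ) * (x * x ^ (α * φ - 1)) := by
      rw [← e1, ← Real.mul_rpow hlam.le hx0.le, ← Real.rpow_mul hy.le, ← Real.rpow_add hy]
      congr 1
      field_simp
      ring
    have e3 : ((lam * x) ^ α) ^ (φ + 1 + 1 / α - 1) =
        ((lam * x) ^ α) ^ (φ + 1 / α - 1) * (lam * x) ^ α := by
      rw [← Real.rpow_add_one hw.ne']
      congr 1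
      ring
    simp only [g, Function.comp, gwlPdf]
    rw [e3]
    have e4 : ∀ A B W E : ℝ, (A * W * E + lam * (A * E)) * (lam * α * B) =
        (A * B) * (lam * α * E * (lam + W)) := by intros; ring
    rw [e4, e2]
    field_simp
  rw [hpt, hsub, hμ]
  have : 0 < 1 / α + φ + lam := by positivity
  generalize 1 / α + φ + lam = K at *
  generalize Real.Gamma (1 / α + φ) = K2 at *
  have : 0 < lam + φ := by positivity
  field_simp
end
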